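/- arXiv:2011.12822 — 4 statements merged into one kernel-verified Lean document; each statement's English description precedes it below -/
import Mathlib

section
/- For every positive integer k there exists a nonempty word W over a three-letter alphabet whose number of distinct square-free reducts satisfies r(W) ≥ k. -/
/-- A single square reduction: a word `U ++ (X ++ X) ++ V` (with `X` nonempty)
is replaced by `U ++ X ++ V`. -/
def Step {α : Type*} (W W' : List α) : Prop :=
  ∃ U X V : List α, X ≠ [] ∧ W = U ++ (X ++ X) ++ V ∧ W' = U ++ X ++ V

/-- `Reaches W W'` : `W'` is obtainable from `W` by a finite sequence of square reductions. -/
def Reaches {α : Type*} (W W' : List α) : Prop := Relation.ReflTransGen Step W W'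

/-- A word is square-free if it contains no square `X ++ X` (with `X` nonempty) as a factor. -/
def SquareFree {α : Type*} (W : List α) : Prop :=
  ∀ X : List α, X ≠ [] → ¬ (X ++ X) <:+: W

/-- The set of square-free reducts of `W`. -/
def Reducts {α : Type*} (W : List α) : Set (List α) := {R | Reaches W R ∧ SquareFree R}

/-- The images of the six letters under a square-free morphism to three letters, each a word of
length 22 written as a number in base 3, least significant digit first. -/
def blockCode : Fin 6 → ℕ := ![25259770360, 25236859348, 22367136997, 25258176037, 25237675099, 22392694279]

/-- The code of the concatenation of three blocks. -/
def blockCode₃ (a b c : Fin 6) : ℕ := blockCode a + 3 ^ 22 * (blockCode b + 3 ^ 22 * blockCode c)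

/-- The ternary letter in position `t` of the word with code `N`. -/
def digit (N t : ℕ) : Fin 3 := Fin.ofNat 3 (N / 3 ^ t)

/-- The image of a letter under the morphism. -/
def block (a : Fin 6) : List (Fin 3) := (List.range 22).map (digit (blockCode a))

theorem blockCode_lt : ∀ a, blockCode a < 3 ^ 22 := by decide +kernel

theorem blockCode₃_no_square : ∀ a b c : Fin 6, a ≠ b → b ≠ c → ∀ n < 23, 0 < n → ∀ r < 22,
    blockCode₃ a b c / 3 ^ r % 3 ^ n ≠ blockCode₃ a b c / 3 ^ (r + n) % 3 ^ n := by
  decide +kernel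

theorem blockCode_synchronizing : ∀ r < 22, ∀ s < r, ∀ a c : Fin 6,
    blockCode a / 3 ^ r % 3 ^ (22 - r) = blockCode c / 3 ^ s % 3 ^ (22 - r) → ∀ b, b ≠ a →
    blockCode b % 3 ^ (r - s) ≠ blockCode c / 3 ^ (22 - r + s) % 3 ^ (r - s) := by
  decide +kernel

theorem squareFree_iff_getElem? {α : Type*} (l : List α) :
    SquareFree l ↔ ∀ p n, 0 < n → p + 2 * n ≤ l.length → ∃ j < n, l[p + j]? ≠ l[p + n + j]? := by
  constructor
  · intro h p n hn hp
    by_contra! hj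
    refine h ((l.drop p).take n) ?_ ?_
    · rw [← List.length_pos_iff]
      simp only [List.length_take, List.length_drop]
      omega
    · have h₁ : (l.drop p).take n = (l.drop (p + n)).take n := by
        ext1 j
        simp only [List.getElem?_take, List.getElem?_drop]
        split_ifs with hjn
        · exact hj j hjn
        · rfl
      have h₂ : (l.drop p).take n ++ (l.drop p).take n = (l.drop p).take (n + n) := by
        conv_lhs => rw [h₁]
        rw [← h₁, List.take_add, h₁, List.drop_drop]
      rw [h₂]
      exact (List.take_prefix _ _).isInfix.trans (List.drop_suffix _ _).isInfix
  · rintro h X hX ⟨s, t, rfl⟩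
    obtain ⟨j, hj, hne⟩ := h s.length X.length (List.length_pos_iff.mpr hX) (by simp; omega)
    apply hne
    simp [List.append_assoc, List.getElem?_append, hj, Nat.add_assoc]

theorem SquareFree.map {α β : Type*} {f : α → β} (hf : Function.Injective f) {l : List α}
    (h : SquareFree l) : SquareFree (l.map f) := by
  rw [squareFree_iff_getElem?] at h ⊢
  intro p n hn hp
  obtain ⟨j, hj, hne⟩ := h p n hn (by simpa using hp)
  refine ⟨j, hj, fun he => hne ?_⟩
  simp only [List.getElem?_map] at he
  exact Option.map_injective hf he

theorem digit_val (N t : ℕ) : (digit N t : ℕ) = N / 3 ^ t % 3 := rfl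

theorem div_mod_eq_of_digit_eq {N M p q n : ℕ}
    (h : ∀ j < n, digit N (p + j) = digit M (q + j)) :
    N / 3 ^ p % 3 ^ n = M / 3 ^ q % 3 ^ n := by
  induction n with
  | zero => simp [Nat.mod_one]
  | succ n ih =>
    have hn := congrArg Fin.val (h n n.lt_succ_self)
    rw [digit_val, digit_val, pow_add, pow_add, ← Nat.div_div_eq_div_mul,
      ← Nat.div_div_eq_div_mul] at hn
    rw [Nat.mod_pow_succ, Nat.mod_pow_succ, hn, ih fun j hj => h j (by omega)]

theorem digit_add_mul_of_lt {A B t : ℕ} (ht : t < 22) : digit (A + 3 ^ 22 * B) t = digit A t := by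
  apply Fin.ext
  obtain ⟨d, hd⟩ := Nat.exists_eq_add_of_lt ht
  rw [digit_val, digit_val, hd, show 3 ^ (t + d + 1) * B = 3 ^ t * (3 * (3 ^ d * B)) by ring,
    Nat.add_mul_div_left _ _ (by positivity), Nat.add_mul_mod_self_left]

theorem digit_add_mul_of_ge {A B t : ℕ} (hA : A < 3 ^ 22) :
    digit (A + 3 ^ 22 * B) (22 + t) = digit B t := by
  apply Fin.ext
  rw [digit_val, digit_val, pow_add, ← Nat.div_div_eq_div_mul,
    Nat.add_mul_div_left _ _ (by positivity), Nat.div_eq_of_lt hA, zero_add]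

theorem blockCode₃_square {a b c : Fin 6} {n r : ℕ} (hn : n < 23) (hn₀ : 0 < n) (hr : r < 22)
    (h : ∀ j < n, digit (blockCode₃ a b c) (r + j) = digit (blockCode₃ a b c) (r + n + j)) :
    a = b ∨ b = c := by
  by_contra! hne
  exact blockCode₃_no_square a b c hne.1 hne.2 n hn hn₀ r hr (div_mod_eq_of_digit_eq h)

theorem digit_blockCode₃_fst {a b c : Fin 6} {t : ℕ} (ht : t < 22) :
    digit (blockCode₃ a b c) t = digit (blockCode a) t :=
  digit_add_mul_of_lt ht

theorem digit_blockCode₃_snd {a b c : Fin 6} {t : ℕ} (ht : t < 22) :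
    digit (blockCode₃ a b c) (22 + t) = digit (blockCode b) t :=
  (digit_add_mul_of_ge (blockCode_lt a)).trans (digit_add_mul_of_lt ht)

theorem digit_blockCode₃_thd {a b c : Fin 6} {t : ℕ} :
    digit (blockCode₃ a b c) (22 + (22 + t)) = digit (blockCode c) t :=
  (digit_add_mul_of_ge (blockCode_lt a)).trans (digit_add_mul_of_ge (blockCode_lt b))

theorem blockCode_injective {a b : Fin 6}
    (h : ∀ t < 22, digit (blockCode a) t = digit (blockCode b) t) : a = b := by
  obtain ⟨c, hc⟩ := exists_ne b
  refine (blockCode₃_square (c := c) (n := 22) (r := 0) (by simp) (by simp) (by simp)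
    fun j hj => ?_).resolve_right hc.symm
  rw [zero_add, zero_add, digit_blockCode₃_fst hj, digit_blockCode₃_snd hj, h j hj]

theorem length_block (a : Fin 6) : (block a).length = 22 := by simp [block]

theorem length_flatMap_block (w : List (Fin 6)) : (w.flatMap block).length = 22 * w.length := by
  induction w with
  | nil => rfl
  | cons a w ih => simp [length_block, ih]; omega

theorem getElem?_flatMap_block (w : List (Fin 6)) (k : ℕ) {t : ℕ} (ht : t < 22) :
    (w.flatMap block)[22 * k + t]? = w[k]?.map fun a => digit (blockCode a) t := by
  induction w generalizing k with
  | nil => simp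
  | cons a w ih =>
    rw [List.flatMap_cons, List.getElem?_append, length_block]
    cases k with
    | zero => simp [ht, block]
    | succ k =>
      rw [if_neg (by omega), show 22 * (k + 1) + t - 22 = 22 * k + t by omega, ih]
      simp

theorem SquareFree.getElem?_ne_succ {α : Type*} {w : List α} (hw : SquareFree w) {k : ℕ}
    (hk : k + 1 < w.length) : w[k]? ≠ w[k + 1]? := by
  obtain ⟨j, hj, hne⟩ := (squareFree_iff_getElem? w).mp hw k 1 one_pos (by omega)
  obtain rfl : j = 0 := by omega
  exact hne

theorem SquareFree.exists_next {w : List (Fin 6)} (hw : SquareFree w) {k : ℕ}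
    {a : Fin 6} (ha : w[k]? = some a) :
    ∃ b, a ≠ b ∧ (k + 1 < w.length → w[k + 1]? = some b) := by
  by_cases hk : k + 1 < w.length
  · refine ⟨w[k + 1], fun h => hw.getElem?_ne_succ hk ?_, fun _ => List.getElem?_eq_getElem hk⟩
    rw [ha, h, List.getElem?_eq_getElem hk]
  · obtain ⟨b, hb⟩ := exists_ne a
    exact ⟨b, hb.symm, fun h => absurd h hk⟩

theorem flatMap_block_short_square {w : List (Fin 6)} (hw : SquareFree w) {i r n : ℕ}
    (hr : r < 22) (hn : n < 22) (hn₀ : 0 < n) (hp : 22 * i + r + 2 * n ≤ 22 * w.length) :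
    ∃ j < n, (w.flatMap block)[22 * i + r + j]? ≠ (w.flatMap block)[22 * i + r + n + j]? := by
  by_contra! h
  have ha : w[i]? = some w[i] := List.getElem?_eq_getElem (by omega)
  obtain ⟨b, hab, hb⟩ := hw.exists_next ha
  obtain ⟨c, hbc, hc⟩ : ∃ c, b ≠ c ∧ (i + 2 < w.length → w[i + 2]? = some c) := by
    by_cases hi : i + 1 < w.length
    · exact hw.exists_next (hb hi)
    · obtain ⟨c, hc⟩ := exists_ne b
      exact ⟨c, hc.symm, fun h => by omega⟩
  have key : ∀ t, t < 66 → 22 * i + t < 22 * w.length →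
      (w.flatMap block)[22 * i + t]? = some (digit (blockCode₃ w[i] b c) t) := by
    intro t ht hlt
    rcases lt_or_ge t 22 with h₁ | h₁
    · rw [getElem?_flatMap_block _ _ h₁, ha, digit_blockCode₃_fst h₁]; rfl
    obtain ⟨t, rfl⟩ := Nat.exists_eq_add_of_le h₁
    rcases lt_or_ge t 22 with h₂ | h₂
    · rw [show 22 * i + (22 + t) = 22 * (i + 1) + t by ring, getElem?_flatMap_block _ _ h₂,
        hb (by omega), digit_blockCode₃_snd h₂]; rfl
    obtain ⟨t, rfl⟩ := Nat.exists_eq_add_of_le h₂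
    rw [show 22 * i + (22 + (22 + t)) = 22 * (i + 2) + t by ring,
      getElem?_flatMap_block _ _ (by omega), hc (by omega), digit_blockCode₃_thd]; rfl
  refine (blockCode₃_square (a := w[i]) (b := b) (c := c) (by omega) hn₀ hr
    fun j hj => ?_).elim hab hbc
  have := h j hj
  rw [add_assoc, add_assoc, add_assoc, ← add_assoc r, key _ (by omega) (by omega),
    key _ (by omega) (by omega)] at this
  exact Option.some_injective _ this

theorem flatMap_block_synchronizing {w : List (Fin 6)} (hw : SquareFree w) {i k r s : ℕ}
    (hr : r < 22) (hs : s < r) (hi : 22 * i + r + 22 ≤ 22 * w.length)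
    (hk : 22 * k + s + 22 ≤ 22 * w.length) :
    ∃ j < 22, (w.flatMap block)[22 * i + r + j]? ≠ (w.flatMap block)[22 * k + s + j]? := by
  by_contra! h
  have ha : w[i]? = some w[i] := List.getElem?_eq_getElem (by omega)
  have hb : w[i + 1]? = some w[i + 1] := List.getElem?_eq_getElem (by omega)
  have hc : w[k]? = some w[k] := List.getElem?_eq_getElem (by omega)
  refine blockCode_synchronizing r hr s hs w[i] w[k] (div_mod_eq_of_digit_eq fun j hj => ?_)
    w[i + 1] (fun he => hw.getElem?_ne_succ (k := i) (by omega) (by rw [ha, hb, he])) ?_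
  · have := h j (by omega)
    rw [add_assoc, add_assoc, getElem?_flatMap_block _ _ (by omega),
      getElem?_flatMap_block _ _ (by omega), ha, hc] at this
    exact Option.some_injective _ this
  · have := div_mod_eq_of_digit_eq (N := blockCode w[i + 1]) (M := blockCode w[k]) (p := 0)
      (q := 22 - r + s) (n := r - s) fun j hj => ?_
    · simpa using this
    have := h (22 - r + j) (by omega)
    rw [show 22 * i + r + (22 - r + j) = 22 * (i + 1) + j by omega,
      show 22 * k + s + (22 - r + j) = 22 * k + (22 - r + s + j) by omega,
      getElem?_flatMap_block _ _ (by omega), getElem?_flatMap_block _ _ (by omega), hb, hc] at this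
    rw [zero_add]
    exact Option.some_injective _ this

theorem SquareFree.flatMap_block {w : List (Fin 6)} (hw : SquareFree w) :
    SquareFree (w.flatMap block) := by
  rw [squareFree_iff_getElem?]
  intro p n hn hp
  rw [length_flatMap_block] at hp
  obtain ⟨i, r, hr, rfl⟩ : ∃ i r, r < 22 ∧ p = 22 * i + r :=
    ⟨p / 22, p % 22, Nat.mod_lt _ (by simp), (Nat.div_add_mod p 22).symm⟩
  rcases lt_or_ge n 22 with hn₁ | hn₁
  · exact flatMap_block_short_square hw hr hn₁ hn hp
  by_contra! h
  obtain ⟨k, s, hs, hks⟩ : ∃ k s, s < 22 ∧ 22 * i + r + n = 22 * k + s :=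
    ⟨_, _, Nat.mod_lt _ (by simp), (Nat.div_add_mod (22 * i + r + n) 22).symm⟩
  rcases lt_trichotomy s r with hsr | rfl | hsr
  · obtain ⟨j, hj, hne⟩ := flatMap_block_synchronizing hw (i := i) (k := k) hr hsr (by omega)
      (by omega)
    exact hne (hks ▸ h j (by omega))
  · obtain ⟨q, rfl⟩ : ∃ q, n = 22 * q := ⟨k - i, by omega⟩
    have hmem : ∀ k, k < w.length → ∃ a, w[k]? = some a := fun k hk =>
      ⟨_, List.getElem?_eq_getElem hk⟩
    have hpos : ∀ k t, t < 22 → 22 * i + s ≤ 22 * k + t → 22 * k + t < 22 * i + s + 22 * q →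
        w[k]?.map (fun a => digit (blockCode a) t) =
          w[k + q]?.map fun a => digit (blockCode a) t := by
      intro k t ht h₁ h₂
      have := h (22 * k + t - (22 * i + s)) (by omega)
      rwa [show 22 * i + s + (22 * k + t - (22 * i + s)) = 22 * k + t by omega,
        show 22 * i + s + 22 * q + (22 * k + t - (22 * i + s)) = 22 * (k + q) + t by omega,
        getElem?_flatMap_block _ _ ht, getElem?_flatMap_block _ _ ht] at this
    have hfull : ∀ k, i < k → k < i + q → w[k]? = w[k + q]? := by
      intro k h₁ h₂
      obtain ⟨a, ha⟩ := hmem k (by omega)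
      obtain ⟨b, hb⟩ := hmem (k + q) (by omega)
      rw [ha, hb, blockCode_injective (a := a) (b := b) fun t ht => ?_]
      have := hpos k t ht (by omega) (by omega)
      rw [ha, hb] at this
      exact Option.some_injective _ this
    obtain ⟨a, ha⟩ := hmem i (by omega)
    obtain ⟨b, hb⟩ := hmem (i + q) (by omega)
    have hab : a ≠ b := by
      rintro rfl
      obtain ⟨j, hj, hne⟩ := (squareFree_iff_getElem? w).mp hw i q (by omega) (by omega)
      rcases Nat.eq_zero_or_pos j with rfl | hj₀
      · exact hne (by simpa using ha.trans hb.symm)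
      · rw [add_right_comm] at hne
        exact hne (hfull _ (by omega) (by omega))
    obtain ⟨c, hbc, hc⟩ : ∃ c, b ≠ c ∧ (0 < s → w[i + q + q]? = some c) := by
      rcases Nat.eq_zero_or_pos s with rfl | hs₀
      · obtain ⟨c, hc⟩ := exists_ne b
        exact ⟨c, hc.symm, fun h => absurd h (lt_irrefl 0)⟩
      obtain ⟨c, hc⟩ := hmem (i + q + q) (by omega)
      refine ⟨c, ?_, fun _ => hc⟩
      rintro rfl
      obtain ⟨j, hj, hne⟩ := (squareFree_iff_getElem? w).mp hw (i + 1) q (by omega) (by omega)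
      rw [add_right_comm (i + 1)] at hne
      rcases Nat.lt_or_ge (j + 1) q with hjq | hjq
      · exact hne (hfull _ (by omega) (by omega))
      · obtain rfl : q = j + 1 := by omega
        rw [show i + 1 + j = i + (j + 1) by omega] at hne
        exact hne (hb.trans hc.symm)
    refine (blockCode₃_square (a := a) (b := b) (c := c) (n := 22) (r := s) (by simp) (by simp) hr
      fun j hj => ?_).elim hab hbc
    rw [add_right_comm, add_comm _ 22]
    rcases lt_or_ge (s + j) 22 with hj | hj
    · have := hpos i (s + j) hj (by omega) (by omega)
      rw [ha, hb] at this
      rw [digit_blockCode₃_fst hj, digit_blockCode₃_snd hj]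
      exact Option.some_injective _ this
    · obtain ⟨t, ht⟩ := Nat.exists_eq_add_of_le hj
      have := hpos (i + q) t (by omega) (by omega) (by omega)
      rw [hb, hc (by omega)] at this
      rw [ht, digit_blockCode₃_snd (by omega), digit_blockCode₃_thd]
      exact Option.some_injective _ this
  · obtain ⟨j, hj, hne⟩ := flatMap_block_synchronizing hw (i := k) (k := i) hs hsr (by omega)
      (by omega)
    exact hne (hks ▸ (h j (by omega)).symm)

theorem Step.append {α : Type*} {W W' : List α} (h : Step W W') (A B : List α) :
    Step (A ++ W ++ B) (A ++ W' ++ B) := by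
  obtain ⟨U, X, V, hX, rfl, rfl⟩ := h
  exact ⟨A ++ U, X, V ++ B, hX, by simp, by simp⟩

theorem Step.flatMap {α β : Type*} {f : α → List β} (hf : ∀ a, f a ≠ []) {W W' : List α}
    (h : Step W W') : Step (W.flatMap f) (W'.flatMap f) := by
  obtain ⟨U, X, V, hX, rfl, rfl⟩ := h
  refine ⟨U.flatMap f, X.flatMap f, V.flatMap f, fun h => ?_, by simp, by simp⟩
  obtain ⟨a, ha⟩ := List.exists_mem_of_ne_nil X hX
  exact hf a (List.flatMap_eq_nil_iff.mp h a ha)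

theorem Reaches.append {α : Type*} {A A' B B' : List α} (hA : Reaches A A') (hB : Reaches B B') :
    Reaches (A ++ B) (A' ++ B') := by
  refine (Relation.ReflTransGen.lift (· ++ B) (fun _ _ h => ?_) _ _ hA).trans
    (Relation.ReflTransGen.lift (A' ++ ·) (fun _ _ h => ?_) _ _ hB)
  · simpa using h.append [] B
  · simpa using h.append A' []

theorem Reaches.flatMap {α β : Type*} {f : α → List β} (hf : ∀ a, f a ≠ []) {W W' : List α}
    (h : Reaches W W') : Reaches (W.flatMap f) (W'.flatMap f) :=
  Relation.ReflTransGen.lift (List.flatMap f) (fun _ _ h => Step.flatMap hf h) _ _ h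

theorem Reaches.length_le {α : Type*} {W W' : List α} (h : Reaches W W') :
    W'.length ≤ W.length := by
  induction h with
  | refl => exact le_rfl
  | tail _ h ih =>
    obtain ⟨U, X, V, -, rfl, rfl⟩ := h
    simp only [List.length_append] at ih ⊢
    omega

theorem finite_reducts {α : Type*} [Finite α] (W : List α) : (Reducts W).Finite :=
  (List.finite_length_le α W.length).subset fun _ h => h.1.length_le

/-- A word with the two reducts `shortReduct` and `longReduct`. -/
def seed : List (Fin 6) := [0, 1, 2, 1, 0, 1, 2, 1, 2]

/-- The shorter reduct of `seed`. -/
def shortReduct : List (Fin 6) := [0, 1, 2]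

/-- The longer reduct of `seed`. -/
def longReduct : List (Fin 6) := [0, 1, 2, 1, 0, 1, 2]

theorem seed_reaches_longReduct : Reaches seed longReduct :=
  .single ⟨[0, 1, 2, 1, 0], [1, 2], [], by simp, rfl, rfl⟩

theorem seed_reaches_shortReduct : Reaches seed shortReduct :=
  .head (b := [0, 1, 2, 1, 2]) ⟨[], [0, 1, 2, 1], [2], by simp, rfl, rfl⟩
    (.single ⟨[0], [1, 2], [], by simp, rfl, rfl⟩)

theorem squareFree_longReduct : SquareFree longReduct := by
  have h : ∀ p < 7, ∀ n < 4, 0 < n → p + 2 * n ≤ 7 →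
      ∃ j < n, longReduct[p + j]? ≠ longReduct[p + n + j]? := by decide
  rw [squareFree_iff_getElem?]
  intro p n hn hp
  have hp' : p + 2 * n ≤ 7 := hp
  exact h p (by omega) n (by omega) hn hp'

/-- The letters of `u` interleaved with copies of `longReduct`, `j` of them, and then with copies
of `shortReduct`. -/
def interleave : List (Fin 6) → ℕ → List (Fin 6)
  | [], _ => []
  | d :: u, 0 => d :: (shortReduct ++ interleave u 0)
  | d :: u, j + 1 => d :: (longReduct ++ interleave u j)

theorem length_interleave (u : List (Fin 6)) {j : ℕ} (hj : j ≤ u.length) :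
    (interleave u j).length = 4 * u.length + 4 * j := by
  induction u generalizing j with
  | nil => simp_all [interleave]
  | cons d u ih =>
    cases j with
    | zero => simp [interleave, shortReduct, ih]; omega
    | succ j => simp [interleave, longReduct, ih (Nat.le_of_succ_le_succ hj)]; omega

theorem reaches_interleave (u : List (Fin 6)) (j : ℕ) :
    Reaches (u.flatMap fun d => d :: seed) (interleave u j) := by
  induction u generalizing j with
  | nil => exact .refl
  | cons d u ih =>
    have h (R : List (Fin 6)) (j : ℕ) (hR : Reaches seed R) :
        Reaches (d :: (seed ++ u.flatMap fun d => d :: seed)) (d :: (R ++ interleave u j)) :=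
      Reaches.append (A := [d]) (A' := [d]) .refl (hR.append (ih j))
    cases j with
    | zero => exact h _ _ seed_reaches_shortReduct
    | succ j => exact h _ _ seed_reaches_longReduct

theorem filter_interleave {u : List (Fin 6)} (hu : ∀ d ∈ u, 3 ≤ d) (j : ℕ) :
    (interleave u j).filter (3 ≤ ·) = u := by
  have hs : shortReduct.filter (3 ≤ ·) = [] := by decide
  have hl : longReduct.filter (3 ≤ ·) = [] := by decide
  induction u generalizing j with
  | nil => rfl
  | cons d u ih =>
    have hd : 3 ≤ d := hu d (by simp)
    have hu' : ∀ d ∈ u, 3 ≤ d := fun d hd => hu d (by simp [hd])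
    cases j <;> simp [interleave, hd, hs, hl, ih hu']

theorem List.IsInfix.of_append_cons {α : Type*} {Y A B : List α} {d : α}
    (h : Y <:+: A ++ d :: B) (hd : d ∉ Y) : Y <:+: A ∨ Y <:+: B := by
  obtain ⟨s, t, h⟩ := h
  rw [List.append_assoc, List.append_eq_append_iff] at h
  obtain ⟨A', rfl, h⟩ | ⟨C, rfl, h⟩ := h
  · rw [List.append_eq_append_iff] at h
    obtain ⟨A'', rfl, -⟩ | ⟨C, rfl, h⟩ := h
    · exact .inl ⟨s, A'', by simp⟩
    · cases C with
      | nil => exact .inl ⟨s, [], by simp⟩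
      | cons e C =>
        obtain ⟨rfl, -⟩ := List.cons_eq_cons.mp h
        simp at hd
  · cases C with
    | nil =>
      cases Y with
      | nil => exact .inl (List.nil_infix)
      | cons e Y =>
        obtain ⟨rfl, -⟩ := List.cons_eq_cons.mp h
        simp at hd
    | cons e C =>
      obtain ⟨rfl, rfl⟩ := List.cons_eq_cons.mp h
      exact .inr ⟨C, t, by simp⟩

theorem infix_longReduct_of_infix_interleave {u : List (Fin 6)} {Y : List (Fin 6)}
    (hY : ∀ d ∈ u, d ∉ Y) {A : List (Fin 6)} {j : ℕ} (hA : A <:+: longReduct)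
    (h : Y <:+: A ++ interleave u j) : Y <:+: longReduct := by
  have hs : shortReduct <:+: longReduct := by decide
  induction u generalizing A j with
  | nil => exact List.IsInfix.trans (by simpa [interleave] using h) hA
  | cons d u ih =>
    have hu : ∀ d ∈ u, d ∉ Y := fun d hd => hY d (by simp [hd])
    cases j with
    | zero =>
      exact (h.of_append_cons (hY d (by simp))).elim (·.trans hA) fun h => ih hu hs h
    | succ j =>
      exact (h.of_append_cons (hY d (by simp))).elim (·.trans hA) fun h =>
        ih hu List.infix_rfl h

theorem squareFree_interleave {u : List (Fin 6)} (hu : ∀ d ∈ u, 3 ≤ d) (hsq : SquareFree u)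
    (j : ℕ) : SquareFree (interleave u j) := by
  intro X hX h
  have hf := h.filter (3 ≤ ·)
  rw [filter_interleave hu, List.filter_append] at hf
  have hnil : X.filter (3 ≤ ·) = [] := by
    by_contra hne
    exact hsq _ hne hf
  refine squareFree_longReduct X hX (infix_longReduct_of_infix_interleave (u := u) (A := [])
    (j := j) (fun d hd hdX => ?_) (List.nil_infix) (by simpa using h))
  have hdX' : d ∈ X := by simpa using hdX
  exact List.filter_eq_nil_iff.mp hnil d hdX' (by simpa using hu d hd)

theorem exists_squareFree_of_length_gt (n : ℕ) :
    ∃ u : List (Fin 6), n < u.length ∧ (∀ d ∈ u, 3 ≤ d) ∧ SquareFree u := by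
  induction n with
  | zero =>
    refine ⟨[3], by simp, by simp, (squareFree_iff_getElem? _).mpr fun p n hn hp => ?_⟩
    simp at hp
    omega
  | succ n ih =>
    obtain ⟨u, hn, -, hu⟩ := ih
    refine ⟨(u.flatMap block).map (Fin.natAdd 3), ?_, ?_,
      hu.flatMap_block.map (Fin.natAdd_injective 3 3)⟩
    · rw [List.length_map, length_flatMap_block]
      omega
    · intro d hd
      obtain ⟨a, -, rfl⟩ := List.mem_map.mp hd
      exact Fin.le_def.mpr (Nat.le_add_right 3 a)

/-- For every positive integer `k` there is a nonempty ternary word with at least `k`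
distinct square-free reducts. -/
theorem ternary_many_reducts (k : ℕ) (hk : 0 < k) :
    ∃ W : List (Fin 3), W ≠ [] ∧ k ≤ (Reducts W).ncard := by
  obtain ⟨u, hlen, hu, hsq⟩ := exists_squareFree_of_length_gt k
  have hblock : ∀ a, block a ≠ [] := fun a h => by simpa [h] using length_block a
  refine ⟨(u.flatMap fun d => d :: seed).flatMap block, fun h => ?_, ?_⟩
  · have h₁ := congrArg List.length h
    have h₂ := (reaches_interleave u 0).length_le
    rw [length_flatMap_block, List.length_nil] at h₁
    rw [length_interleave u (Nat.zero_le _)] at h₂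
    omega
  have hinj : Set.InjOn (fun j => (interleave u j).flatMap block) (Finset.range k) := by
    intro i hi j hj hij
    have := congrArg List.length hij
    simp only [Finset.coe_range, Set.mem_Iio] at hi hj
    simp only [length_flatMap_block] at this
    rw [length_interleave u (by omega), length_interleave u (by omega)] at this
    omega
  calc k = ((fun j => (interleave u j).flatMap block) '' (Finset.range k)).ncard := by
        rw [hinj.ncard_image, Set.ncard_coe_finset, Finset.card_range]
    _ ≤ _ := Set.ncard_le_ncard (by
        rintro _ ⟨j, -, rfl⟩
        exact ⟨(reaches_interleave u j).flatMap hblock,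
          (squareFree_interleave hu hsq j).flatMap_block⟩) (finite_reducts _)
end

section
/- For every positive integer k there exists a nonempty word W over a four-letter alphabet with exactly k distinct square-free reducts, i.e. r(W) = k. -/
section Blocks

variable {α : Type*}

/-- The word `d B₁ d B₂ ⋯ d Bᵣ d e` obtained from the blocks `B₁, …, Bᵣ`. -/
def joinBlocks (d : α) (e : List α) : List (List α) → List α
  | [] => d :: e
  | B :: L => d :: (B ++ joinBlocks d e L)

theorem joinBlocks_eq_cons (d : α) (e : List α) (L : List (List α)) :
    ∃ R, joinBlocks d e L = d :: R := by
  cases L <;> exact ⟨_, rfl⟩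

theorem append_cons_inj_of_notMem {d : α} {A B C D : List α} (hA : d ∉ A) (hB : d ∉ B)
    (h : A ++ d :: C = B ++ d :: D) : A = B ∧ C = D := by
  induction A generalizing B with
  | nil =>
    cases B with
    | nil => simpa using h
    | cons b B => simp at h hB; exact absurd h.1 hB.1
  | cons a A ih =>
    cases B with
    | nil => simp at h hA; exact absurd h.1.symm hA.1
    | cons b B =>
      simp only [List.cons_append, List.cons.injEq, List.mem_cons, not_or] at h hA hB
      obtain ⟨rfl, rfl⟩ := ih hA.2 hB.2 h.2
      exact ⟨by rw [h.1], rfl⟩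

/-- A word free of `d` that starts `T ++ d :: R` is a prefix of `T`. -/
theorem prefix_of_append_eq_append_cons {d : α} {T R Y V : List α} (hY : d ∉ Y)
    (h : T ++ d :: R = Y ++ V) : Y <+: T := by
  rcases List.append_eq_append_iff.1 h with ⟨c, h1, h2⟩ | ⟨c, h1, -⟩
  · cases c with
    | nil => simp [h1]
    | cons a c =>
      simp only [List.cons_append, List.cons.injEq] at h2
      exact absurd (by simp [h1, h2.1]) hY
  · exact ⟨c, h1.symm⟩

theorem SquareFree.of_isInfix {Y W : List α} (hW : SquareFree W) (h : Y <:+: W) : SquareFree Y :=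
  fun X hX hXY => hW X hX (hXY.trans h)

theorem mem_of_joinBlocks_eq {d : α} {e B C : List α} (he : d ∉ e) (hB : d ∉ B)
    {L : List (List α)} (hL : ∀ b ∈ L, d ∉ b) {A : List α}
    (h : joinBlocks d e L = A ++ d :: (B ++ d :: C)) : B ∈ L := by
  induction L generalizing A with
  | nil =>
    cases A with
    | nil => simp [joinBlocks] at h; simp [h] at he
    | cons a A => simp [joinBlocks] at h; simp [h] at he
  | cons b L ih =>
    have hb : d ∉ b := hL b (by simp)
    have ih' := @ih (fun b' hb' => hL b' (by simp [hb']))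
    obtain ⟨R, hR⟩ := joinBlocks_eq_cons d e L
    cases A with
    | nil =>
      simp only [joinBlocks, List.nil_append, List.cons.injEq, true_and] at h
      rw [hR] at h
      simp [(append_cons_inj_of_notMem hb hB h).1]
    | cons a A =>
      simp only [joinBlocks, List.cons_append, List.cons.injEq] at h
      rcases List.append_eq_append_iff.1 h.2 with ⟨c, h1, h2⟩ | ⟨c, h1, h2⟩
      · exact List.mem_cons_of_mem _ (ih' h2)
      · cases c with
        | nil => exact List.mem_cons_of_mem _ (ih' (A := []) (by simpa using h2.symm))
        | cons a' c =>
          simp only [List.cons_append, List.cons.injEq] at h2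
          exact absurd (by simp [h1, h2.1]) hb

theorem exists_joinBlocks_of_leading_square {d : α} {e T X V : List α} {L : List (List α)}
    (he : d ∉ e) (hL : ∀ b ∈ L, d ∉ b) (hnd : L.Nodup) (hT : d ∉ T) (hTs : SquareFree T)
    (hX : X ≠ []) (h : T ++ joinBlocks d e L = X ++ (X ++ V)) :
    ∃ L', L'.Sublist L ∧ X ++ V = T ++ joinBlocks d e L' := by
  by_cases hd : d ∈ X
  · obtain ⟨s, q, rfl, hs⟩ := List.eq_append_cons_of_mem hd
    cases L with
    | nil =>
      simp only [joinBlocks, List.append_assoc, List.cons_append] at h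
      have := (append_cons_inj_of_notMem hT hs h).2
      simp [this] at he
    | cons B L =>
      simp only [joinBlocks, List.append_assoc, List.cons_append] at h
      obtain ⟨rfl, h⟩ := append_cons_inj_of_notMem hT hs h
      have hB : d ∉ B := hL B (by simp)
      obtain ⟨R, hR⟩ := joinBlocks_eq_cons d e L
      by_cases hq : d ∈ q
      · obtain ⟨B', q', rfl, hB'⟩ := List.eq_append_cons_of_mem hq
        rw [hR] at h
        simp only [List.append_assoc, List.cons_append] at h
        obtain ⟨rfl, rfl⟩ := append_cons_inj_of_notMem hB hB' h
        have : B ∈ L := mem_of_joinBlocks_eq he hB (fun b hb => hL b (by simp [hb]))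
          (A := d :: (q' ++ T)) (C := q' ++ V) (by simp [hR])
        exact absurd this (List.nodup_cons.1 hnd).1
      · rw [hR, ← List.append_assoc q] at h
        obtain ⟨rfl, rfl⟩ := append_cons_inj_of_notMem hB (by simp [hq, hT]) h
        exact ⟨L, List.sublist_cons_self _ _, by simp [hR]⟩
  · obtain ⟨R, hR⟩ := joinBlocks_eq_cons d e L
    rw [hR, ← List.append_assoc X] at h
    exact absurd (prefix_of_append_eq_append_cons (by simp [hd]) h).isInfix (hTs X hX)

theorem exists_joinBlocks_of_square {d : α} {e U X V : List α} {L : List (List α)}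
    (he : d ∉ e) (hes : SquareFree e) (hL : ∀ b ∈ L, d ∉ b) (hLs : ∀ b ∈ L, SquareFree b)
    (hnd : L.Nodup) (hX : X ≠ []) (h : joinBlocks d e L = U ++ (X ++ (X ++ V))) :
    ∃ L', L'.Sublist L ∧ U ++ (X ++ V) = joinBlocks d e L' := by
  have hnil : SquareFree ([] : List α) := fun Y hY hYs => hY (by simpa using hYs)
  induction L generalizing U with
  | nil =>
    cases U with
    | nil =>
      exact exists_joinBlocks_of_leading_square he hL hnd (T := []) (X := X) (by simp) hnil hX h
    | cons a U =>
      simp only [joinBlocks, List.cons_append, List.cons.injEq] at h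
      exact absurd ⟨U, V, by simp [h.2]⟩ (hes X hX)
  | cons B L ih =>
    cases U with
    | nil =>
      exact exists_joinBlocks_of_leading_square he hL hnd (T := []) (X := X) (by simp) hnil hX h
    | cons a U =>
      simp only [joinBlocks, List.cons_append, List.cons.injEq] at h
      obtain ⟨rfl, h⟩ := h
      have hL' : ∀ b ∈ L, d ∉ b := fun b hb => hL b (by simp [hb])
      have hnd' := (List.nodup_cons.1 hnd).2
      rcases List.append_eq_append_iff.1 h with ⟨c, rfl, h2⟩ | ⟨T, rfl, h2⟩
      · obtain ⟨L', hs, h'⟩ := ih hL' (fun b hb => hLs b (by simp [hb])) hnd' h2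
        exact ⟨B :: L', hs.cons_cons B, by simp [joinBlocks, ← h']⟩
      · have hUT := hL (U ++ T) (by simp)
        obtain ⟨L', hs, h'⟩ := exists_joinBlocks_of_leading_square he hL' hnd' (T := T)
          (fun hdT => hUT (by simp [hdT]))
          ((hLs (U ++ T) (by simp)).of_isInfix (List.suffix_append U T).isInfix) hX h2.symm
        exact ⟨(U ++ T) :: L', hs.cons_cons _, by simp [joinBlocks, h']⟩

theorem exists_joinBlocks_of_reaches {d : α} {e W : List α} {F : List (List α)}
    (he : d ∉ e) (hes : SquareFree e) (hF : ∀ b ∈ F, d ∉ b) (hFs : ∀ b ∈ F, SquareFree b)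
    (hnd : F.Nodup) (h : Reaches (joinBlocks d e F) W) :
    ∃ L, L.Sublist F ∧ W = joinBlocks d e L := by
  induction h with
  | refl => exact ⟨F, List.Sublist.refl F, rfl⟩
  | tail _ hstep ih =>
    obtain ⟨L, hs, rfl⟩ := ih
    obtain ⟨U, X, V, hX, h1, rfl⟩ := hstep
    obtain ⟨L', hs', h'⟩ := exists_joinBlocks_of_square he hes (fun b hb => hF b (hs.subset hb))
      (fun b hb => hFs b (hs.subset hb)) (hnd.sublist hs) hX (U := U) (V := V) (by simp [h1])
    exact ⟨L', hs'.trans hs, by simp [← h']⟩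

theorem Step.append_left (A : List α) {W W' : List α} (h : Step W W') :
    Step (A ++ W) (A ++ W') := by
  obtain ⟨U, X, V, hX, rfl, rfl⟩ := h
  exact ⟨A ++ U, X, V, hX, by simp, by simp⟩

theorem Reaches.append_left (A : List α) {W W' : List α} (h : Reaches W W') :
    Reaches (A ++ W) (A ++ W') :=
  Relation.ReflTransGen.lift (A ++ ·) (fun _ _ => Step.append_left A) _ _ h

theorem joinBlocks_map_eq_append {d x : α} {e p : List α} {ps : List (List α)}
    (h : (p :: (ps ++ [e])).Pairwise (· <+: ·)) :
    ∃ R, joinBlocks d e (ps.map (· ++ [x])) = d :: (p ++ R) := by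
  have h1 := (List.pairwise_cons.1 h).1
  cases ps with
  | nil =>
    obtain ⟨R, hR⟩ := h1 e (by simp)
    exact ⟨R, by simp [joinBlocks, hR]⟩
  | cons q ps =>
    obtain ⟨R, rfl⟩ := h1 q (by simp)
    exact ⟨_, by simp [joinBlocks]; rfl⟩

theorem reaches_joinBlocks_of_sublist {d x : α} {e : List α} {qs ps : List (List α)}
    (hs : qs.Sublist ps) (h : (ps ++ [e]).Pairwise (· <+: ·)) :
    Reaches (x :: joinBlocks d e (ps.map (· ++ [x]))) (x :: joinBlocks d e (qs.map (· ++ [x]))) := by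
  induction hs with
  | slnil => exact Relation.ReflTransGen.refl
  | @cons qs ps p _ ih =>
    refine Relation.ReflTransGen.head ?_ (ih (List.pairwise_cons.1 h).2)
    obtain ⟨R, hR⟩ := joinBlocks_map_eq_append (d := d) (x := x) h
    exact ⟨[], x :: d :: p, R, by simp, by simp [joinBlocks, hR], by simp [hR]⟩
  | @cons_cons qs ps p _ ih =>
    have := (ih (List.pairwise_cons.1 h).2).append_left (x :: d :: p)
    simpa [joinBlocks] using this

/-- A chain of prefixes `p` of `e`, each of which can be extended by the common first letter `x`
without creating a square and without remaining a prefix of `e`, yields a word with one more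
reduct than there are prefixes in the chain. -/
theorem ncard_reducts_joinBlocks {d x : α} {e : List α} {ps : List (List α)}
    (hdx : d ≠ x) (he : d ∉ e) (hes : SquareFree e) (hex : [x] <+: e)
    (hchain : (ps ++ [e]).Pairwise (· <+: ·)) (hnd : ps.Nodup)
    (hpx : ∀ p ∈ ps, [x] <+: p) (hps : ∀ p ∈ ps, SquareFree (p ++ [x]))
    (hpe : ∀ p ∈ ps, ¬ p ++ [x] <+: e) :
    (Reducts (joinBlocks d e ([x] :: ps.map (· ++ [x])))).ncard = ps.length + 1 := by
  classical
  have hdp : ∀ p ∈ ps, d ∉ p := fun p hp hd =>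
    he (((List.pairwise_append.1 hchain).2.2 p hp e (by simp)).subset hd)
  have hF : ∀ b ∈ [x] :: ps.map (· ++ [x]), d ∉ b := by
    simp only [List.mem_cons, List.mem_map, forall_eq_or_imp]
    refine ⟨by simpa using hdx, ?_⟩
    rintro _ ⟨p, hp, rfl⟩
    simp [hdx, hdp p hp]
  have hFs : ∀ b ∈ [x] :: ps.map (· ++ [x]), SquareFree b := by
    simp only [List.mem_cons, List.mem_map, forall_eq_or_imp]
    refine ⟨hes.of_isInfix hex.isInfix, ?_⟩
    rintro _ ⟨p, hp, rfl⟩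
    exact hps p hp
  have hFnd : ([x] :: ps.map (· ++ [x])).Nodup := by
    refine List.nodup_cons.2 ⟨?_, hnd.map fun _ _ h => List.append_cancel_right h⟩
    simp only [List.mem_map, not_exists, not_and]
    intro p hp h
    have hp0 : p = [] := by simpa using h
    simpa [hp0] using hpx p hp
  obtain ⟨e', he'⟩ := hex
  have key : Reducts (joinBlocks d e ([x] :: ps.map (· ++ [x]))) =
      ((joinBlocks d e [] :: ps.map fun p => joinBlocks d e [p ++ [x]]).toFinset :
        Set (List α)) := by
    ext W
    simp only [List.coe_toFinset, Set.mem_ofPred_eq, List.mem_cons, List.mem_map]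
    constructor
    · rintro ⟨hr, hsf⟩
      obtain ⟨L, hL, rfl⟩ := exists_joinBlocks_of_reaches he hes hF hFs hFnd hr
      rcases List.sublist_cons_iff.1 hL with hL | ⟨L', rfl, hL'⟩
      · obtain ⟨qs, hqs, rfl⟩ := List.sublist_map_iff.1 hL
        match qs, hqs with
        | [], _ => exact Or.inl rfl
        | [p], hqs => exact Or.inr ⟨p, hqs.subset (by simp), rfl⟩
        | p :: q :: qs, hqs =>
          have hc : (q :: (qs ++ [e])).Pairwise (· <+: ·) :=
            (List.pairwise_cons.1 (hchain.sublist (hqs.append_right [e]))).2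
          obtain ⟨R, hR⟩ := joinBlocks_map_eq_append (d := d) (x := x) hc
          exact absurd ⟨d :: p, R, by simp [joinBlocks, hR]⟩ (hsf (x :: d :: q) (by simp))
      · obtain ⟨qs, hqs, rfl⟩ := List.sublist_map_iff.1 hL'
        have hc : ([x] :: (qs ++ [e])).Pairwise (· <+: ·) := by
          refine List.pairwise_cons.2 ⟨?_, hchain.sublist (hqs.append_right [e])⟩
          intro q hq
          rcases List.mem_append.1 hq with hq | hq
          · exact hpx q (hqs.subset hq)
          · rw [List.mem_singleton.1 hq]; exact ⟨e', he'⟩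
        obtain ⟨R, hR⟩ := joinBlocks_map_eq_append (d := d) (x := x) hc
        exact absurd ⟨[], R, by simp [joinBlocks, hR]⟩ (hsf [d, x] (by simp))
    · rintro (rfl | ⟨p, hp, rfl⟩)
      · refine ⟨?_, ?_⟩
        · have := (reaches_joinBlocks_of_sublist (d := d) (x := x)
            (List.nil_sublist ps) hchain).append_left [d]
          refine Relation.ReflTransGen.tail this ⟨[], [d, x], e', by simp, ?_, ?_⟩
          · simp [joinBlocks, ← he']
          · simp [joinBlocks, ← he']
        · rintro X hX ⟨U, V, h⟩
          obtain ⟨L, hL, h'⟩ := exists_joinBlocks_of_square (L := []) he hes (by simp) (by simp)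
            (by simp) hX (U := U) (V := V) (by simp [← h])
          rw [List.sublist_nil.1 hL, ← h] at h'
          exact hX (by simpa using congrArg List.length h')
      · refine ⟨?_, ?_⟩
        · have := (reaches_joinBlocks_of_sublist (d := d) (x := x)
            (List.singleton_sublist.2 hp) hchain).append_left [d]
          obtain ⟨p', rfl⟩ := hpx p hp
          exact Relation.ReflTransGen.tail this ⟨[], [d, x], p' ++ x :: d :: e, by simp,
            by simp [joinBlocks], by simp [joinBlocks]⟩
        · rintro X hX ⟨U, V, h⟩
          have hpF : p ++ [x] ∈ [x] :: ps.map (· ++ [x]) :=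
            List.mem_cons_of_mem _ (List.mem_map_of_mem hp)
          obtain ⟨L, hL, h'⟩ := exists_joinBlocks_of_square (L := [p ++ [x]]) he hes
            (by simpa using hF _ hpF) (by simpa using hFs _ hpF)
            (by simp) hX (U := U) (V := V) (by simp [← h])
          rcases List.sublist_cons_iff.1 hL with hL | ⟨L', rfl, hL'⟩
          · rw [List.sublist_nil.1 hL] at h'
            cases U with
            | nil =>
              simp only [joinBlocks, List.nil_append, List.append_assoc] at h h'
              rw [h'] at h
              have hXp : X = d :: (p ++ [x]) :=
                List.append_cancel_right (h.trans (by simp))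
              rw [hXp] at h'
              simp only [List.cons_append, List.cons.injEq, true_and] at h'
              exact hpe p hp ⟨V, h'⟩
            | cons a U =>
              simp only [joinBlocks, List.cons_append, List.cons.injEq] at h h'
              have hd : d ∈ U ++ (X ++ X) ++ V := by rw [h.2]; simp
              exact he (by rw [← h'.2]; simp at hd ⊢; tauto)
          · rw [List.sublist_nil.1 hL', ← h] at h'
            exact hX (by simpa using congrArg List.length h')
  rw [key, Set.ncard_coe_finset, List.toFinset_card_of_nodup]
  · simp
  · refine List.nodup_cons.2 ⟨?_, hnd.map fun p q h => ?_⟩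
    · simp only [List.mem_map, not_exists, not_and]
      intro p _ h
      have := congrArg List.length h
      simp [joinBlocks] at this
      omega
    · simp only [joinBlocks, List.cons.injEq, true_and] at h
      exact List.append_cancel_right (List.append_cancel_right h)

end Blocks

section ThueMorse

/-- The Thue–Morse sequence. -/
def thueMorse (n : ℕ) : Bool :=
  if n = 0 then false else xor (thueMorse (n / 2)) (n % 2 == 1)
decreasing_by omega

theorem thueMorse_two_mul (n : ℕ) : thueMorse (2 * n) = thueMorse n := by
  rcases Nat.eq_zero_or_pos n with rfl | hn
  · rfl
  · rw [thueMorse]; simp [hn.ne']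

theorem thueMorse_two_mul_add_one (n : ℕ) : thueMorse (2 * n + 1) = !thueMorse n := by
  rw [thueMorse]
  simp [show (2 * n + 1) / 2 = n by omega, show (2 * n + 1) % 2 = 1 by omega]

theorem thueMorse_succ_ne_of_even {n : ℕ} (h : n % 2 = 0) : thueMorse (n + 1) ≠ thueMorse n := by
  obtain ⟨m, rfl⟩ : ∃ m, n = 2 * m := ⟨n / 2, by omega⟩
  rw [thueMorse_two_mul, thueMorse_two_mul_add_one]
  simp

theorem thueMorse_overlap_free (p : ℕ) (hp : 0 < p) (i : ℕ) :
    ¬ ∀ j ≤ p, thueMorse (i + j) = thueMorse (i + p + j) := by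
  induction p using Nat.strong_induction_on generalizing i with
  | _ p ih =>
    intro h
    rcases Nat.even_or_odd' p with ⟨q, rfl | rfl⟩
    · refine ih q (by omega) (by omega) (i / 2) fun j hj => ?_
      have := h (2 * j) (by omega)
      rcases Nat.even_or_odd' i with ⟨m, rfl | rfl⟩
      · rwa [show 2 * m + 2 * j = 2 * (2 * m / 2 + j) by omega,
          show 2 * m + 2 * q + 2 * j = 2 * (2 * m / 2 + q + j) by omega,
          thueMorse_two_mul, thueMorse_two_mul] at this
      · rw [show 2 * m + 1 + 2 * j = 2 * ((2 * m + 1) / 2 + j) + 1 by omega,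
          show 2 * m + 1 + 2 * q + 2 * j = 2 * ((2 * m + 1) / 2 + q + j) + 1 by omega,
          thueMorse_two_mul_add_one, thueMorse_two_mul_add_one] at this
        simpa using this
    · have alt : ∀ j < 2 * (2 * q + 1), thueMorse (i + j + 1) ≠ thueMorse (i + j) := by
        have low : ∀ j < 2 * q + 1, thueMorse (i + j + 1) ≠ thueMorse (i + j) ∧
            thueMorse (i + (2 * q + 1) + j + 1) ≠ thueMorse (i + (2 * q + 1) + j) := by
          intro j hj
          have h0 := h j (by omega)
          have h1 := h (j + 1) (by omega)
          simp only [← Nat.add_assoc] at h0 h1 ⊢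
          rcases Nat.mod_two_eq_zero_or_one (i + j) with hm | hm
          · have := thueMorse_succ_ne_of_even hm
            exact ⟨this, by rwa [← h0, ← h1]⟩
          · have := thueMorse_succ_ne_of_even (n := i + 2 * q + 1 + j) (by omega)
            exact ⟨by rwa [h0, h1], this⟩
        intro j hj
        rcases Nat.lt_or_ge j (2 * q + 1) with hj' | hj'
        · exact (low j hj').1
        · have := (low (j - (2 * q + 1)) (by omega)).2
          rwa [show i + (2 * q + 1) + (j - (2 * q + 1)) = i + j by omega] at this
      rcases Nat.eq_zero_or_pos q with rfl | hq
      · exact alt 0 (by omega) (by simpa using (h 0 (by omega)).symm)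
      · have a : ∀ m, i ≤ m → m ≤ i + 5 → thueMorse (m + 1) = !thueMorse m := by
          intro m h1 h2
          have := alt (m - i) (by omega)
          rw [show i + (m - i) = m by omega] at this
          simpa [Bool.eq_not_iff] using this
        have e : ∀ m, 2 * m + 1 = i ∨ 2 * m = i → False := by
          intro m hm
          have a2 := a (2 * m + 1) (by omega) (by omega)
          have a4 := a (2 * m + 3) (by omega) (by omega)
          rw [show 2 * m + 1 + 1 = 2 * (m + 1) by ring, thueMorse_two_mul,
            thueMorse_two_mul_add_one] at a2
          rw [show 2 * m + 3 + 1 = 2 * (m + 2) by ring, show 2 * m + 3 = 2 * (m + 1) + 1 by ring,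
            thueMorse_two_mul, thueMorse_two_mul_add_one] at a4
          have b := thueMorse_succ_ne_of_even (n := m)
          have c := thueMorse_succ_ne_of_even (n := m + 1)
          rcases Nat.mod_two_eq_zero_or_one m with hm | hm
          · simp_all
          · exact c (by omega) (by simpa using a4)
        rcases Nat.even_or_odd' i with ⟨m, hm | hm⟩
        · exact e m (Or.inr hm.symm)
        · exact e m (Or.inl hm.symm)

/-- The sequence of differences of consecutive terms of the Thue–Morse sequence, with `0`, `1`, `2`
encoding the differences `0`, `1`, `-1`. -/
def thueMorseDiff (n : ℕ) : Fin 4 :=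
  if thueMorse (n + 1) = thueMorse n then 0 else if thueMorse (n + 1) then 1 else 2

/-- If the differences agree on two windows of length `p`, then either the Thue–Morse sequence
itself agrees on the windows, or it is constant on each of them. -/
theorem thueMorse_of_diff_eq {i k p : ℕ}
    (h : ∀ j < p, thueMorseDiff (i + j) = thueMorseDiff (k + j)) :
    (∀ j ≤ p, thueMorse (i + j) = thueMorse (k + j)) ∨
      ∀ j ≤ p, thueMorse (i + j) = thueMorse i ∧ thueMorse (k + j) = !thueMorse i := by
  by_cases h0 : thueMorse i = thueMorse k
  · left
    intro j hj
    induction j with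
    | zero => exact h0
    | succ j ih =>
      have h1 := h j (by omega)
      have h2 := ih (by omega)
      simp only [thueMorseDiff, ← Nat.add_assoc] at *
      revert h1 h2
      cases thueMorse (i + j) <;> cases thueMorse (k + j) <;> cases thueMorse (i + j + 1) <;>
        cases thueMorse (k + j + 1) <;> simp
  · right
    intro j hj
    induction j with
    | zero => exact ⟨rfl, by simpa [Bool.eq_not_iff] using fun h => h0 h.symm⟩
    | succ j ih =>
      have h1 := h j (by omega)
      have h2 := ih (by omega)
      simp only [thueMorseDiff, ← Nat.add_assoc] at *
      revert h1 h2
      cases thueMorse (i + j) <;> cases thueMorse (k + j) <;> cases thueMorse (i + j + 1) <;>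
        cases thueMorse (k + j + 1) <;> simp

theorem thueMorseDiff_square_free {i p : ℕ} (hp : 0 < p) :
    ¬ ∀ j < p, thueMorseDiff (i + j) = thueMorseDiff (i + p + j) := by
  intro h
  rcases thueMorse_of_diff_eq h with h | h
  · exact thueMorse_overlap_free p hp i h
  · have h1 := (h p le_rfl).1
    have h2 := (h 0 (Nat.zero_le p)).2
    simp [h1] at h2

/-- The prefix of length `n` of the Thue–Morse difference sequence. -/
def thueMorsePrefix (n : ℕ) : List (Fin 4) := (List.range n).map thueMorseDiff

theorem length_thueMorsePrefix (n : ℕ) : (thueMorsePrefix n).length = n := by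
  simp [thueMorsePrefix]

theorem thueMorsePrefix_succ (n : ℕ) :
    thueMorsePrefix (n + 1) = thueMorsePrefix n ++ [thueMorseDiff n] := by
  simp [thueMorsePrefix, List.range_succ]

theorem thueMorsePrefix_mono {m n : ℕ} (h : m ≤ n) : thueMorsePrefix m <+: thueMorsePrefix n := by
  induction n, h using Nat.le_induction with
  | base => exact List.prefix_rfl
  | succ n _ ih =>
    rw [thueMorsePrefix_succ]
    exact ih.trans (List.prefix_append _ _)

theorem exists_period_of_square_factor {α : Type*} {g : ℕ → α} {N : ℕ} {X : List α} (hX : X ≠ [])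
    (h : X ++ X <:+: (List.range N).map g) :
    ∃ i p, 0 < p ∧ i + 2 * p ≤ N ∧ ∀ j < p, g (i + j) = g (i + p + j) := by
  obtain ⟨U, V, h⟩ := h
  have hlen := congrArg List.length h
  simp only [List.length_append, List.length_map, List.length_range] at hlen
  refine ⟨U.length, X.length, List.length_pos_iff.2 hX, by omega, fun j hj => ?_⟩
  have h1 := congrArg (fun l => l[U.length + j]?) h
  have h2 := congrArg (fun l => l[U.length + X.length + j]?) h
  have e1 : (U ++ (X ++ X) ++ V)[U.length + j]? = X[j]? := by
    simp [List.getElem?_append, hj]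
  have e2 : (U ++ (X ++ X) ++ V)[U.length + X.length + j]? = X[j]? := by
    have : U ++ (X ++ X) ++ V = (U ++ X) ++ (X ++ V) := by simp
    rw [this, ← List.length_append, List.getElem?_append_right (by omega)]
    simp [List.getElem?_append, hj]
  simp only [e1, e2] at h1 h2
  rw [List.getElem?_map, List.getElem?_range (by omega)] at h1 h2
  simpa using h1.symm.trans h2

theorem squareFree_thueMorsePrefix (n : ℕ) : SquareFree (thueMorsePrefix n) := by
  intro X hX h
  obtain ⟨i, p, hp, -, h⟩ := exists_period_of_square_factor hX h
  exact thueMorseDiff_square_free hp h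

theorem squareFree_thueMorsePrefix_append {n : ℕ} (h0 : thueMorse n = true)
    (h1 : thueMorse (n + 1) = false) (h2 : thueMorse (n + 2) = true)
    (h3 : thueMorse (n + 3) = true) : SquareFree (thueMorsePrefix (n + 3) ++ [1]) := by
  intro X hX h
  have hg : thueMorsePrefix (n + 3) ++ [1] =
      (List.range (n + 4)).map fun i => if i < n + 3 then thueMorseDiff i else 1 := by
    rw [List.range_succ, List.map_append, thueMorsePrefix]
    congr 1
    · exact List.map_congr_left fun i hi => by simp [List.mem_range.1 hi]
    · simp
  rw [hg] at h
  obtain ⟨i, p, hp, hip, h⟩ := exists_period_of_square_factor hX h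
  rcases Nat.lt_or_ge (i + 2 * p) (n + 4) with hlt | hge
  · refine thueMorseDiff_square_free hp (i := i) fun j hj => ?_
    have := h j hj
    rwa [if_pos (by omega), if_pos (by omega)] at this
  · obtain ⟨q, rfl⟩ : ∃ q, p = q + 1 := ⟨p - 1, by omega⟩
    have hend := h q (by omega)
    rw [if_pos (by omega), if_neg (by omega)] at hend
    have hq : thueMorse (i + q) = false := by
      simp only [thueMorseDiff] at hend
      revert hend
      cases thueMorse (i + q) <;> cases thueMorse (i + q + 1) <;> simp
    have hn : i + (q + 1) + q = n + 3 := by omega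
    rcases thueMorse_of_diff_eq (i := i) (k := i + (q + 1)) (p := q) (fun j hj => by
      have := h j (by omega)
      rwa [if_pos (by omega), if_pos (by omega)] at this) with hc | hc
    · have := hc q le_rfl
      rw [hn, h3, hq] at this
      simp at this
    · have hi : thueMorse i = false := by rw [← (hc q le_rfl).1, hq]
      rcases lt_trichotomy q 1 with hq1 | rfl | hq1
      · obtain rfl : q = 0 := by omega
        rw [show i + 0 = n + 2 by omega, h2] at hq
        simp at hq
      · rw [show i = n by omega, h0] at hi
        simp at hi
      · have := (hc (q - 2) (by omega)).2
        rw [show i + (q + 1) + (q - 2) = n + 1 by omega, h1, hi] at this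
        simp at this

theorem exists_strictMono_thueMorse : ∃ f : ℕ → ℕ, StrictMono f ∧ ∀ m,
    thueMorse (f m) = true ∧ thueMorse (f m + 1) = false ∧ thueMorse (f m + 2) = true ∧
      thueMorse (f m + 3) = true ∧ thueMorse (f m + 4) = false := by
  have key : ∀ m, ∃ r, 2 * m ≤ r ∧ r ≤ 2 * m + 1 ∧ thueMorse r = true := by
    intro m
    cases h : thueMorse m
    · exact ⟨2 * m + 1, by omega, le_rfl, by simp [thueMorse_two_mul_add_one, h]⟩
    · exact ⟨2 * m, le_rfl, by omega, by simp [thueMorse_two_mul, h]⟩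
  choose r hr1 hr2 hr using key
  refine ⟨fun m => 8 * r m + 3, strictMono_nat_of_lt_succ fun m => ?_, fun m => ?_⟩
  · have := hr2 m
    have := hr1 (m + 1)
    omega
  · have ev := thueMorse_two_mul
    have od := thueMorse_two_mul_add_one
    dsimp only
    refine ⟨?_, ?_, ?_, ?_, ?_⟩
    · rw [show 8 * r m + 3 = 2 * (2 * (2 * r m) + 1) + 1 by ring, od, od, ev, hr]; rfl
    · rw [show 8 * r m + 3 + 1 = 2 * (2 * (2 * r m + 1)) by ring, ev, ev, od, hr]; rfl
    · rw [show 8 * r m + 3 + 2 = 2 * (2 * (2 * r m + 1)) + 1 by ring, od, ev, od, hr]; rfl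
    · rw [show 8 * r m + 3 + 3 = 2 * (2 * (2 * r m + 1) + 1) by ring, ev, od, od, hr]; rfl
    · rw [show 8 * r m + 3 + 4 = 2 * (2 * (2 * r m + 1) + 1) + 1 by ring, od, od, od, hr]; rfl

theorem three_notMem_thueMorsePrefix (n : ℕ) : (3 : Fin 4) ∉ thueMorsePrefix n := by
  simp only [thueMorsePrefix, List.mem_map, not_exists, not_and, thueMorseDiff]
  intro i _
  split_ifs <;> decide

theorem singleton_prefix_thueMorsePrefix {n : ℕ} (hn : 0 < n) : [1] <+: thueMorsePrefix n := by
  have h : thueMorsePrefix 1 = [1] := by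
    simp [thueMorsePrefix, thueMorseDiff, thueMorse]
  exact h ▸ thueMorsePrefix_mono hn

end ThueMorse

/-- For every positive integer `k` there is a nonempty word over a four-letter alphabet
with exactly `k` distinct square-free reducts. -/
theorem four_letters_exactly_k_reducts (k : ℕ) (hk : 0 < k) :
    ∃ W : List (Fin 4), W ≠ [] ∧ (Reducts W).ncard = k := by
  obtain ⟨f, hf, hfv⟩ := exists_strictMono_thueMorse
  obtain ⟨n, rfl⟩ : ∃ n, k = n + 1 := ⟨k - 1, by omega⟩
  let ps := (List.range n).map fun m => thueMorsePrefix (f m + 3)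
  refine ⟨joinBlocks 3 (thueMorsePrefix (f n + 3)) ([1] :: ps.map (· ++ [1])),
    by simp [joinBlocks], ?_⟩
  have hps : ∀ p ∈ ps, ∃ m < n, thueMorsePrefix (f m + 3) = p := by
    simp [ps]
  rw [ncard_reducts_joinBlocks (by decide) (three_notMem_thueMorsePrefix _)
    (squareFree_thueMorsePrefix _) (singleton_prefix_thueMorsePrefix (by omega))]
  · simp [ps]
  · have : ps ++ [thueMorsePrefix (f n + 3)] =
        (List.range (n + 1)).map fun m => thueMorsePrefix (f m + 3) := by
      simp [ps, List.range_succ]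
    rw [this, List.pairwise_map]
    refine List.pairwise_lt_range.imp fun {a b} hab => thueMorsePrefix_mono ?_
    have := hf hab
    omega
  · refine List.nodup_range.map fun a b hab => hf.injective ?_
    have := congrArg List.length hab
    simpa [length_thueMorsePrefix] using this
  · intro p hp
    obtain ⟨m, -, rfl⟩ := hps p hp
    exact singleton_prefix_thueMorsePrefix (by omega)
  · intro p hp
    obtain ⟨m, -, rfl⟩ := hps p hp
    obtain ⟨h0, h1, h2, h3, -⟩ := hfv m
    exact squareFree_thueMorsePrefix_append h0 h1 h2 h3
  · intro p hp hpre
    obtain ⟨m, hm, rfl⟩ := hps p hp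
    obtain ⟨-, -, -, h3, h4⟩ := hfv m
    have hlt := hf hm
    have hnext : thueMorsePrefix (f m + 3) ++ [thueMorseDiff (f m + 3)] <+:
        thueMorsePrefix (f n + 3) :=
      thueMorsePrefix_succ (f m + 3) ▸ thueMorsePrefix_mono (by omega)
    have heq := (List.prefix_of_prefix_length_le hpre hnext (by simp)).eq_of_length (by simp)
    simp [thueMorseDiff, h3, h4] at heq
end

section
/- Let U be a word over {a,b,x} starting and ending with the letter x. Let S be an infinite square-free word over {a,b,y} starting with the letter y, and let T be obtained from S by duplicating every occurrence of the letter y except the first; write T uniquely as T = T_1 T_2 T_3 ⋯ where each factor T_i starts and ends with y and contains no other occurrence of y. For j ≥ 1 set V_j = U T_1 U T_2 ⋯ U T_j. Then r(V_j) = r(U)^j for every j ≥ 1. -/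
namespace SquareReduction

/-- Transitions of the automaton reading concatenations of blocks `A y w y`, where `A` is a word
over `{a, b, x}` starting and ending with `x` and `w` is a nonempty word over `{a, b}`.
State `0` expects the start of `A`, states `1` and `2` lie in `A` (after an `x`, resp. after
another letter), state `3` lies right after the opening `y`, state `4` lies inside `w`, and
state `5` is the failure state. -/
def next : Fin 6 → Fin 4 → Fin 6
  | 0, 2 => 1
  | 1, 2 => 1
  | 1, 0 => 2
  | 1, 1 => 2
  | 1, 3 => 3
  | 2, 2 => 1
  | 2, 0 => 2
  | 2, 1 => 2
  | 3, 0 => 4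
  | 3, 1 => 4
  | 4, 0 => 4
  | 4, 1 => 4
  | 4, 3 => 0
  | _, _ => 5

/-- The state reached from `q` after reading a word. -/
def run (q : Fin 6) (W : List (Fin 4)) : Fin 6 := W.foldl next q

/-- `flip s W` is `s`, negated once for every letter `y` of `W`. -/
def flip (s : Bool) (W : List (Fin 4)) : Bool := W.foldl (fun s c => if c = 3 then !s else s) s

/-- Delete the `x`-blocks of a word: in state `true` (outside the blocks `y w y`) letters are
erased up to the next `y`, in state `false` letters are kept up to the next `y`, which is
erased. -/
def erase : Bool → List (Fin 4) → List (Fin 4)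
  | _, [] => []
  | true, c :: W => if c = 3 then 3 :: erase false W else erase true W
  | false, c :: W => if c = 3 then erase true W else c :: erase false W

/-- Words over `{a, b, x}` starting and ending with `x`. -/
def IsBlock (A : List (Fin 4)) : Prop := 3 ∉ A ∧ A.head? = some 2 ∧ A.getLast? = some 2

/-- Nonempty words over `{a, b}`. -/
def IsInner (w : List (Fin 4)) : Prop := w ≠ [] ∧ 2 ∉ w ∧ 3 ∉ w

/-- The words `A₁ y w₁ y A₂ y w₂ y ⋯` with all `Aᵢ` in `C`. -/
def Blocks (C : Set (List (Fin 4))) : List (List (Fin 4)) → Set (List (Fin 4))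
  | [] => {[]}
  | w :: ws => {W | ∃ A ∈ C, ∃ R ∈ Blocks C ws, W = A ++ 3 :: (w ++ 3 :: R)}

lemma run_append (q : Fin 6) (A B : List (Fin 4)) : run q (A ++ B) = run (run q A) B := by
  simp [run]

lemma run_cons (q : Fin 6) (c : Fin 4) (B : List (Fin 4)) :
    run q (c :: B) = run (next q c) B := rfl

lemma run_nil (q : Fin 6) : run q [] = q := rfl

lemma flip_append (s : Bool) (A B : List (Fin 4)) : flip s (A ++ B) = flip (flip s A) B := by
  simp [flip]

lemma flip_cons (s : Bool) (c : Fin 4) (B : List (Fin 4)) :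
    flip s (c :: B) = flip (if c = 3 then !s else s) B := rfl

lemma flip_nil (s : Bool) : flip s [] = s := rfl

lemma flip_not (s : Bool) (A : List (Fin 4)) : flip (!s) A = !flip s A := by
  induction A generalizing s with
  | nil => rfl
  | cons c A ih =>
    by_cases hc : c = 3 <;> simp [flip_cons, hc, ih]

lemma flip_of_notMem (s : Bool) {A : List (Fin 4)} (h : 3 ∉ A) : flip s A = s := by
  induction A with
  | nil => rfl
  | cons c A ih =>
    simp only [List.mem_cons, not_or] at h
    rw [flip_cons, if_neg (Ne.symm h.1), ih h.2]

lemma run_fail (A : List (Fin 4)) : run 5 A = 5 := by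
  induction A with
  | nil => rfl
  | cons c A ih => rw [run_cons, show next 5 c = 5 from by revert c; decide, ih]

lemma run_ne_of_append {q : Fin 6} {A B : List (Fin 4)} (h : run q (A ++ B) ≠ 5) :
    run q A ≠ 5 := by
  intro hA
  rw [run_append, hA, run_fail] at h
  exact h rfl

lemma decide_run_lt (q : Fin 6) (A : List (Fin 4)) (h : run q A ≠ 5) :
    decide (run q A < 3) = flip (decide (q < 3)) A := by
  induction A generalizing q with
  | nil => rfl
  | cons c A ih =>
    rw [run_cons] at h ⊢
    have hq : next q c ≠ 5 := by
      intro hq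
      rw [hq, run_fail] at h
      exact h rfl
    rw [ih _ h, flip_cons]
    clear ih h
    congr 1
    revert q c
    decide

/-- A `y` read in an accepted word is opening iff it is not followed by `x`. -/
lemma flip_of_pair_left {P Q : List (Fin 4)} {c : Fin 4} (h : run 0 (P ++ 3 :: c :: Q) ≠ 5) :
    c ≠ 3 ∧ flip true P = decide (c ≠ 2) := by
  have hP := run_ne_of_append h
  have e := decide_run_lt 0 P hP
  rw [show P ++ 3 :: c :: Q = P ++ [3, c] ++ Q by simp] at h
  have h2 := run_ne_of_append h
  rw [run_append] at h2
  simp only [run_cons, run_nil] at h2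
  rw [show flip true P = decide (run 0 P < 3) from e.symm]
  clear h hP e
  generalize run 0 P = q at h2 ⊢
  revert q c
  decide

/-- A `y` read in an accepted word is opening iff it is preceded by `x`. -/
lemma flip_of_pair_right {P Q : List (Fin 4)} {c : Fin 4} (h : run 0 (P ++ c :: 3 :: Q) ≠ 5) :
    flip true P = decide (c = 2) := by
  have hP := run_ne_of_append h
  have e := decide_run_lt 0 P hP
  rw [show P ++ c :: 3 :: Q = P ++ [c, 3] ++ Q by simp] at h
  have h2 := run_ne_of_append h
  rw [run_append] at h2
  simp only [run_cons, run_nil] at h2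
  rw [show flip true P = decide (run 0 P < 3) from e.symm]
  clear h hP e
  generalize run 0 P = q at h2 ⊢
  revert q c
  decide

lemma erase_append (s : Bool) (A B : List (Fin 4)) :
    erase s (A ++ B) = erase s A ++ erase (flip s A) B := by
  induction A generalizing s with
  | nil => simp [erase, flip_nil]
  | cons c A ih =>
    cases s <;> by_cases hc : c = 3 <;> simp [erase, flip_cons, hc, ih]

lemma erase_false_of_notMem {A : List (Fin 4)} (h : 3 ∉ A) : erase false A = A := by
  induction A with
  | nil => rfl
  | cons c A ih =>
    simp only [List.mem_cons, not_or] at h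
    simp [erase, Ne.symm h.1, ih h.2]

lemma erase_true_of_notMem {A : List (Fin 4)} (h : 3 ∉ A) : erase true A = [] := by
  induction A with
  | nil => rfl
  | cons c A ih =>
    simp only [List.mem_cons, not_or] at h
    simp [erase, Ne.symm h.1, ih h.2]

lemma erase_true_ne_nil {A : List (Fin 4)} (h : flip true A = false) : erase true A ≠ [] := by
  induction A with
  | nil => simp [flip_nil] at h
  | cons c A ih =>
    by_cases hc : c = 3
    · simp [erase, hc]
    · simp only [flip_cons, hc, if_false] at h
      simpa [erase, hc] using ih h

lemma erase_ne_nil {s : Bool} {A : List (Fin 4)} (h : flip s A = s) (hA : 3 ∈ A) :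
    erase s A ≠ [] := by
  induction A with
  | nil => simp at hA
  | cons c A ih =>
    by_cases hc : c = 3
    · cases s
      · simp only [flip_cons, hc, if_true] at h
        simpa [erase, hc] using erase_true_ne_nil h
      · simp [erase, hc]
    · simp only [flip_cons, hc, if_false] at h
      have hA' : 3 ∈ A := by
        rcases List.mem_cons.1 hA with h' | h'
        · exact absurd h'.symm hc
        · exact h'
      cases s
      · simp [erase, hc]
      · simpa [erase, hc] using ih h hA'

lemma run_outer {B : List (Fin 4)} (h : 3 ∉ B) : run 1 B = 1 ∨ run 1 B = 2 := by
  induction B using List.reverseRecOn with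
  | nil => simp [run_nil]
  | append_singleton B c ih =>
    simp only [List.mem_append, List.mem_singleton, not_or] at h
    rw [run_append]
    simp only [run_cons, run_nil]
    have hc := h.2
    rcases ih h.1 with e | e <;> rw [e] <;> clear e ih h <;> revert c <;> decide

lemma IsBlock.run_eq {A : List (Fin 4)} (h : IsBlock A) : run 0 A = 1 := by
  obtain ⟨h3, hh, hl⟩ := h
  cases A with
  | nil => simp at hh
  | cons c B =>
    obtain rfl : c = 2 := by simpa using hh
    rw [run_cons]
    change run 1 B = 1
    rcases List.eq_nil_or_concat B with rfl | ⟨B', d, rfl⟩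
    · rfl
    · simp only [List.concat_eq_append] at *
      obtain rfl : d = 2 := by
        rw [← List.cons_append, List.getLast?_append] at hl
        simpa using hl
      have h3' : 3 ∉ B' := by simp_all
      rw [run_append]
      rcases run_outer h3' with e | e <;> rw [e] <;> rfl

lemma run_inner {w : List (Fin 4)} (h2 : 2 ∉ w) (h3 : 3 ∉ w) : run 4 w = 4 := by
  induction w with
  | nil => rfl
  | cons c w ih =>
    simp only [List.mem_cons, not_or] at h2 h3
    have hc : next 4 c = 4 := by
      have a := h2.1
      have b := h3.1
      clear ih h2 h3
      revert c
      decide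
    rw [run_cons, hc, ih h2.2 h3.2]

lemma IsInner.run_eq {w : List (Fin 4)} (h : IsInner w) : run 3 w = 4 := by
  obtain ⟨h0, h2, h3⟩ := h
  cases w with
  | nil => exact absurd rfl h0
  | cons c w =>
    simp only [List.mem_cons, not_or] at h2 h3
    have hc : next 3 c = 4 := by
      have a := h2.1
      have b := h3.1
      clear h0 h2 h3
      revert c
      decide
    rw [run_cons, hc, run_inner h2.2 h3.2]

lemma Blocks.run_eq {C : Set (List (Fin 4))} (hC : ∀ A ∈ C, IsBlock A)
    {ws : List (List (Fin 4))} (hws : ∀ w ∈ ws, IsInner w) {W : List (Fin 4)}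
    (hW : W ∈ Blocks C ws) : run 0 W = 0 := by
  induction ws generalizing W with
  | nil =>
    obtain rfl : W = [] := hW
    rfl
  | cons w ws ih =>
    obtain ⟨A, hA, R, hR, rfl⟩ := hW
    rw [run_append, (hC A hA).run_eq, run_cons]
    change run 3 _ = 0
    rw [run_append, (hws w (by simp)).run_eq, run_cons]
    exact ih (fun v hv => hws v (by simp [hv])) hR

lemma Blocks.erase_eq {C : Set (List (Fin 4))} (hC : ∀ A ∈ C, IsBlock A)
    {ws : List (List (Fin 4))} (hws : ∀ w ∈ ws, IsInner w) {W : List (Fin 4)}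
    (hW : W ∈ Blocks C ws) : erase true W = ws.flatMap (3 :: ·) := by
  induction ws generalizing W with
  | nil =>
    obtain rfl : W = [] := hW
    rfl
  | cons w ws ih =>
    obtain ⟨A, hA, R, hR, rfl⟩ := hW
    have hA3 := (hC A hA).1
    have hw3 := (hws w (by simp)).2.2
    rw [erase_append, erase_true_of_notMem hA3, flip_of_notMem _ hA3]
    simp only [erase, if_true]
    rw [erase_append, erase_false_of_notMem hw3, flip_of_notMem _ hw3]
    simp [erase, ih (fun v hv => hws v (by simp [hv])) hR]

/-- Every square of a word in `Blocks C ws` avoids `y` and starts outside the factors `y w y`. -/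
lemma Blocks.square {C : Set (List (Fin 4))} (hC : ∀ A ∈ C, IsBlock A)
    {ws : List (List (Fin 4))} (hws : ∀ w ∈ ws, IsInner w)
    (hsf : SquareFree (ws.flatMap (3 :: ·))) {P X Q : List (Fin 4)} (hX : X ≠ [])
    (hW : P ++ (X ++ X) ++ Q ∈ Blocks C ws) : 3 ∉ X ∧ flip true P = true := by
  have hrun : run 0 (P ++ (X ++ X) ++ Q) ≠ 5 := by rw [run_eq hC hws hW]; decide
  have her := erase_eq hC hws hW
  by_cases hpar : flip (flip true P) X = flip true P
  · have hnil : erase (flip true P) X = [] := by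
      by_contra hne
      refine hsf _ hne ⟨erase true P, erase (flip true P) Q, ?_⟩
      rw [← her]
      simp [erase_append, hpar]
    have h3 : 3 ∉ X := fun h => erase_ne_nil hpar h hnil
    refine ⟨h3, ?_⟩
    cases hs : flip true P
    · rw [hs, erase_false_of_notMem h3] at hnil
      exact absurd hnil hX
    · rfl
  · exfalso
    have hodd : ∀ A, flip true (P ++ (X ++ A)) = !flip true (P ++ A) := by
      intro A
      rw [flip_append, flip_append, flip_append, Bool.eq_not_of_ne hpar, flip_not]
    have h3 : 3 ∈ X := by
      by_contra h
      exact hpar (flip_of_notMem _ h)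
    obtain ⟨A, B, rfl⟩ := List.append_of_mem h3
    have hA := hodd A
    cases B with
    | cons c B =>
      have h1 := flip_of_pair_left (P := P ++ A) (c := c)
        (Q := B ++ (A ++ 3 :: c :: B) ++ Q) (by simpa using hrun)
      have h2 := flip_of_pair_left (P := P ++ ((A ++ 3 :: c :: B) ++ A)) (c := c)
        (Q := B ++ Q) (by simpa using hrun)
      rw [h1.2, h2.2] at hA
      exact Bool.eq_not_self _ |>.mp hA
    | nil =>
      rcases List.eq_nil_or_concat A with rfl | ⟨A', c, rfl⟩
      · exact (flip_of_pair_left (P := P) (c := 3) (Q := Q) (by simpa using hrun)).1 rfl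
      · simp only [List.concat_eq_append] at *
        have h1 := flip_of_pair_right (P := P ++ A') (c := c)
          (Q := A' ++ [c] ++ [3] ++ Q) (by simpa using hrun)
        have h2 := flip_of_pair_right (P := P ++ ((A' ++ [c] ++ [3]) ++ A')) (c := c)
          (Q := Q) (by simpa using hrun)
        have hA' := hodd A'
        rw [h1, h2] at hA'
        exact Bool.eq_not_self _ |>.mp hA'

/-- A nonempty `y`-free factor lying outside the factors `y w y` lies inside some block, and can
be replaced there. -/
lemma Blocks.locate {C : Set (List (Fin 4))} (hC : ∀ A ∈ C, 3 ∉ A)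
    {ws : List (List (Fin 4))} (hws : ∀ w ∈ ws, 3 ∉ w) {P M Q : List (Fin 4)} (hM : M ≠ [])
    (hM3 : 3 ∉ M) (hP : flip true P = true) (hW : P ++ M ++ Q ∈ Blocks C ws) :
    ∃ B D, B ++ M ++ D ∈ C ∧ ∀ M', B ++ M' ++ D ∈ C → P ++ M' ++ Q ∈ Blocks C ws := by
  induction ws generalizing P with
  | nil =>
    have h : P ++ M ++ Q = [] := hW
    exact absurd (by simp_all only [List.append_eq_nil_iff]) hM
  | cons w ws ih =>
    obtain ⟨A, hA, R, hR, e⟩ := hW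
    have hw3 := hws w (by simp)
    have key : ∀ (K L : List (Fin 4)), M ++ Q = K ++ 3 :: L → ∃ D, K = M ++ D := by
      intro K L h
      rcases List.append_eq_append_iff.1 h with ⟨D, h1, -⟩ | ⟨D, h1, h2⟩
      · exact ⟨D, h1⟩
      · cases D with
        | nil => exact ⟨[], by simpa using h1.symm⟩
        | cons d D =>
          obtain ⟨rfl, -⟩ := List.cons_eq_cons.1 h2
          exact absurd (by simp [h1]) hM3
    rw [List.append_assoc] at e
    rcases List.append_eq_append_iff.1 e with ⟨K, h1, h2⟩ | ⟨P', rfl, h2⟩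
    · obtain ⟨D, rfl⟩ := key K _ h2
      refine ⟨P, D, by rwa [List.append_assoc, ← h1], fun M' hM' => ?_⟩
      have hQ : Q = D ++ 3 :: (w ++ 3 :: R) := by simpa using h2
      exact ⟨_, hM', R, hR, by simp [hQ]⟩
    · rw [flip_append, flip_of_notMem _ (hC A hA)] at hP
      cases P' with
      | nil =>
        obtain ⟨D, h⟩ := key [] _ h2.symm
        exact absurd (List.append_eq_nil_iff.1 h.symm).1 hM
      | cons d P' =>
        obtain ⟨rfl, h3⟩ := List.cons_eq_cons.1 h2
        rw [flip_cons, if_pos rfl] at hP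
        rcases List.append_eq_append_iff.1 h3 with ⟨P'', rfl, h4⟩ | ⟨K, rfl, h4⟩
        · rw [flip_append, flip_of_notMem _ hw3] at hP
          cases P'' with
          | nil => simp [flip_nil] at hP
          | cons d P'' =>
            obtain ⟨rfl, rfl⟩ := List.cons_eq_cons.1 h4
            rw [flip_cons, if_pos rfl] at hP
            obtain ⟨B, D, hBD, hrep⟩ := ih (fun v hv => hws v (by simp [hv])) (P := P'')
              (by simpa using hP) (by simpa using hR)
            refine ⟨B, D, hBD, fun M' hM' => ⟨A, hA, _, hrep M' hM', by simp⟩⟩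
        · rw [flip_of_notMem _ (by simp_all)] at hP
          simp at hP

lemma Blocks.mono {C D : Set (List (Fin 4))} (h : C ⊆ D) (ws : List (List (Fin 4))) :
    Blocks C ws ⊆ Blocks D ws := by
  induction ws with
  | nil => exact subset_rfl
  | cons w ws ih =>
    rintro _ ⟨A, hA, R, hR, rfl⟩
    exact ⟨A, h hA, R, ih hR, rfl⟩

end SquareReduction

section Reduction

variable {α : Type*}

lemma Step.context {W W' : List α} (h : Step W W') (P Q : List α) :
    Step (P ++ W ++ Q) (P ++ W' ++ Q) := by
  obtain ⟨U, X, V, hX, rfl, rfl⟩ := h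
  exact ⟨P ++ U, X, V ++ Q, hX, by simp, by simp⟩

lemma Reaches.context {W W' : List α} (h : Reaches W W') (P Q : List α) :
    Reaches (P ++ W ++ Q) (P ++ W' ++ Q) :=
  Relation.ReflTransGen.lift (fun W => P ++ W ++ Q) (fun _ _ h => Step.context h P Q) _ _ h

lemma SquareFree.of_infix {W W' : List α} (h : SquareFree W) (hW : W' <:+: W) :
    SquareFree W' :=
  fun X hX hXX => h X hX (hXX.trans hW)

end Reduction

namespace SquareReduction

lemma IsBlock.step {A A' : List (Fin 4)} (h : IsBlock A) (hs : Step A A') : IsBlock A' := by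
  obtain ⟨P, X, Q, hX, rfl, rfl⟩ := hs
  obtain ⟨h3, hh, hl⟩ := h
  refine ⟨by simp_all, ?_, ?_⟩
  · rw [← hh]
    simp [List.head?_append, ← Option.or_assoc]
  · rw [← hl]
    simp only [List.getLast?_append]
    cases Q.getLast? <;> cases X.getLast? <;> simp

lemma IsBlock.reaches {A A' : List (Fin 4)} (h : IsBlock A) (hs : Reaches A A') :
    IsBlock A' := by
  induction hs with
  | refl => exact h
  | tail _ hst ih => exact ih.step hst

lemma Blocks.reaches {U : List (Fin 4)} (hU : IsBlock U) {ws : List (List (Fin 4))}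
    (hws : ∀ w ∈ ws, IsInner w) (hsf : SquareFree (ws.flatMap (3 :: ·))) {W W' : List (Fin 4)}
    (hW : W ∈ Blocks {A | Reaches U A} ws) (h : Reaches W W') :
    W' ∈ Blocks {A | Reaches U A} ws := by
  have hC : ∀ A ∈ {A | Reaches U A}, IsBlock A := fun A hA => hU.reaches hA
  induction h with
  | refl => exact hW
  | tail _ hst ih =>
    obtain ⟨P, X, Q, hX, rfl, rfl⟩ := hst
    obtain ⟨h3, hP⟩ := square hC hws hsf hX ih
    obtain ⟨B, D, hBD, hrep⟩ := locate (fun A hA => (hC A hA).1) (fun w hw => (hws w hw).2.2)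
      (by simp [hX]) (by simp [h3]) hP ih
    exact hrep X (Relation.ReflTransGen.tail hBD ⟨B, X, D, hX, rfl, rfl⟩)

lemma Blocks.squareFree_mem {C : Set (List (Fin 4))} {ws : List (List (Fin 4))}
    {W : List (Fin 4)} (hW : W ∈ Blocks C ws) (h : SquareFree W) :
    W ∈ Blocks {A ∈ C | SquareFree A} ws := by
  induction ws generalizing W with
  | nil => exact hW
  | cons w ws ih =>
    obtain ⟨A, hA, R, hR, rfl⟩ := hW
    exact ⟨A, ⟨hA, h.of_infix ⟨[], _, rfl⟩⟩, R,
      ih hR (h.of_infix ⟨A ++ 3 :: (w ++ [3]), [], by simp⟩), rfl⟩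

lemma Blocks.squareFree {C : Set (List (Fin 4))} (hC : ∀ A ∈ C, IsBlock A)
    (hCsf : ∀ A ∈ C, SquareFree A) {ws : List (List (Fin 4))} (hws : ∀ w ∈ ws, IsInner w)
    (hsf : SquareFree (ws.flatMap (3 :: ·))) {W : List (Fin 4)} (hW : W ∈ Blocks C ws) :
    SquareFree W := by
  rintro X hX ⟨P, Q, rfl⟩
  obtain ⟨h3, hP⟩ := square hC hws hsf hX hW
  obtain ⟨B, D, hBD, -⟩ := locate (fun A hA => (hC A hA).1) (fun w hw => (hws w hw).2.2)
    (by simp [hX]) (by simp [h3]) hP hW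
  exact hCsf _ hBD X hX ⟨B, D, rfl⟩

lemma flatMap_mem_Blocks {C : Set (List (Fin 4))} {U : List (Fin 4)} (hU : U ∈ C)
    (ws : List (List (Fin 4))) : ws.flatMap (fun w => U ++ 3 :: (w ++ [3])) ∈ Blocks C ws := by
  induction ws with
  | nil => rfl
  | cons w ws ih => exact ⟨U, hU, _, ih, by simp⟩

lemma Blocks.reaches_of_flatMap {U : List (Fin 4)} {ws : List (List (Fin 4))}
    {W : List (Fin 4)} (hW : W ∈ Blocks {A | Reaches U A} ws) :
    Reaches (ws.flatMap fun w => U ++ 3 :: (w ++ [3])) W := by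
  induction ws generalizing W with
  | nil =>
    obtain rfl : W = [] := hW
    exact Relation.ReflTransGen.refl
  | cons w ws ih =>
    obtain ⟨A, hA, R, hR, rfl⟩ := hW
    have h1 := Reaches.context hA [] (3 :: (w ++ 3 :: ws.flatMap fun w => U ++ 3 :: (w ++ [3])))
    have h2 := (ih hR).context (A ++ 3 :: (w ++ [3])) []
    simp only [List.flatMap_cons, List.append_assoc, List.cons_append, List.nil_append,
      List.append_nil] at h1 h2 ⊢
    exact Relation.ReflTransGen.trans h1 h2

/-- The reducts of `U y w₁ y U y w₂ y ⋯` are obtained by reducing every copy of `U`. -/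
lemma Reducts_flatMap {U : List (Fin 4)} (hU : IsBlock U) {ws : List (List (Fin 4))}
    (hws : ∀ w ∈ ws, IsInner w) (hsf : SquareFree (ws.flatMap (3 :: ·))) :
    Reducts (ws.flatMap fun w => U ++ 3 :: (w ++ [3])) = Blocks (Reducts U) ws := by
  ext W
  constructor
  · rintro ⟨hW, hWsf⟩
    exact Blocks.squareFree_mem (Blocks.reaches hU hws hsf
      (flatMap_mem_Blocks (C := {A | Reaches U A}) Relation.ReflTransGen.refl ws) hW) hWsf
  · intro hW
    exact ⟨Blocks.reaches_of_flatMap (Blocks.mono (fun A hA => hA.1) ws hW),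
      Blocks.squareFree (fun A hA => hU.reaches hA.1) (fun A hA => hA.2) hws hsf hW⟩

lemma append_cons_inj {A A' R R' : List (Fin 4)} (hA : 3 ∉ A) (hA' : 3 ∉ A')
    (h : A ++ 3 :: R = A' ++ 3 :: R') : A = A' ∧ R = R' := by
  rcases List.append_eq_append_iff.1 h with ⟨K, rfl, h2⟩ | ⟨K, rfl, h2⟩ <;> cases K <;> simp_all

lemma ncard_Blocks {C : Set (List (Fin 4))} (hC : ∀ A ∈ C, 3 ∉ A) (ws : List (List (Fin 4))) :
    (Blocks C ws).ncard = C.ncard ^ ws.length := by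
  induction ws with
  | nil => simp [Blocks]
  | cons w ws ih =>
    have himage : Blocks C (w :: ws) =
        (fun z : List (Fin 4) × List (Fin 4) => z.1 ++ 3 :: (w ++ 3 :: z.2)) ''
          (C ×ˢ Blocks C ws) := by
      ext W
      constructor
      · rintro ⟨A, hA, R, hR, rfl⟩
        exact ⟨(A, R), ⟨hA, hR⟩, rfl⟩
      · rintro ⟨⟨A, R⟩, ⟨hA, hR⟩, rfl⟩
        exact ⟨A, hA, R, hR, rfl⟩
    rw [himage, Set.InjOn.ncard_image, Set.ncard_prod, ih, List.length_cons, pow_succ']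
    rintro ⟨A, R⟩ ⟨hA, -⟩ ⟨A', R'⟩ ⟨hA', -⟩ h
    obtain ⟨rfl, h2⟩ := append_cons_inj (hC A hA) (hC A' hA') h
    simpa using h2

end SquareReduction

open SquareReduction in
/-- Let `U` be a word over `{a, b, x}` starting and ending with `x` (alphabet `Fin 4`
with `a = 0`, `b = 1`, `x = 2`, `y = 3`). Let `S` be an infinite square-free word over
`{a, b, y}` starting with `y`, whose occurrences of `y` are at positions
`p 0 = 0 < p 1 < p 2 < ⋯`, and let `T i` (corresponding to `T_{i+1}` in the paper) be the
factor of `S` from position `p i` through `p (i+1)`, so that `T i` starts and ends with `y`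
and has no other `y` (these are the factors of the word `T` obtained from `S` by
duplicating every `y` except the first). With `V j = U T 0 U T 1 ⋯ U T j`, we have
`r(V j) = r(U) ^ (j + 1)` for all `j`. -/
theorem reducts_of_V (U : List (Fin 4))
    (hU : ∀ s ∈ U, s ≠ 3) (hhead : U.head? = some 2) (hlast : U.getLast? = some 2)
    (S : ℕ → Fin 4) (hSalpha : ∀ n, S n ≠ 2) (hS0 : S 0 = 3)
    (hsf : ∀ n, SquareFree ((List.range n).map S))
    (p : ℕ → ℕ) (hmono : StrictMono p) (hp0 : p 0 = 0)
    (hpy : ∀ i, S (p i) = 3) (hyp : ∀ n, S n = 3 → ∃ i, p i = n)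
    (T : ℕ → List (Fin 4))
    (hT : ∀ i, T i = (List.range (p (i + 1) - p i + 1)).map fun j => S (p i + j))
    (V : ℕ → List (Fin 4)) (hV0 : V 0 = U ++ T 0)
    (hVsucc : ∀ j, V (j + 1) = V j ++ U ++ T (j + 1)) :
    ∀ j, (Reducts (V j)).ncard = (Reducts U).ncard ^ (j + 1) := by
  have hUB : IsBlock U := ⟨fun h => hU 3 h rfl, hhead, hlast⟩
  have hlt : ∀ i, p i < p (i + 1) := fun i => hmono (Nat.lt_succ_self i)
  let w : ℕ → List (Fin 4) :=
    fun i => (List.range (p (i + 1) - p i - 1)).map fun k => S (p i + (k + 1))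
  have hcons : ∀ i, (List.range (p (i + 1) - p i)).map (fun k => S (p i + k)) = 3 :: w i := by
    intro i
    have h := hlt i
    rw [show p (i + 1) - p i = (p (i + 1) - p i - 1) + 1 by omega, List.range_succ_eq_map]
    simp [w, hpy, Function.comp_def]
  have hTw : ∀ i, T i = 3 :: (w i ++ [3]) := by
    intro i
    have h := hlt i
    rw [hT, List.range_succ, List.map_append, hcons]
    simp [show p i + (p (i + 1) - p i) = p (i + 1) by omega, hpy]
  have hinner : ∀ i, IsInner (w i) := by
    intro i
    have h := hlt i
    refine ⟨fun h0 => ?_, fun h2 => ?_, fun h3 => ?_⟩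
    · have hp1 : p (i + 1) = p i + 1 := by
        simp only [w, List.map_eq_nil_iff, List.range_eq_nil] at h0
        omega
      refine hsf (p i + 1 + 1) [3] (by simp) ⟨(List.range (p i)).map S, [], ?_⟩
      have h1 : S (p i + 1) = 3 := hp1 ▸ hpy (i + 1)
      simp [List.range_succ, hpy, h1]
    · obtain ⟨k, -, hk⟩ := List.mem_map.1 h2
      exact hSalpha _ hk
    · obtain ⟨k, hk, hk3⟩ := List.mem_map.1 h3
      obtain ⟨m, hm⟩ := hyp _ hk3
      rw [List.mem_range] at hk
      have h1 : i < m := hmono.lt_iff_lt.1 (by omega)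
      have h2 : m < i + 1 := hmono.lt_iff_lt.1 (by omega)
      omega
  have hprefix : ∀ j, ((List.range j).map w).flatMap (3 :: ·) = (List.range (p j)).map S := by
    intro j
    induction j with
    | zero => simp [hp0]
    | succ j ih =>
      have h := hlt j
      rw [List.range_succ, List.map_append, List.flatMap_append, ih,
        show p (j + 1) = p j + (p (j + 1) - p j) by omega, List.range_add, List.map_append,
        List.map_map]
      simpa [Function.comp_def] using (hcons j).symm
  have hV : ∀ j, V j = ((List.range (j + 1)).map w).flatMap fun v => U ++ 3 :: (v ++ [3]) := by
    intro j
    induction j with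
    | zero => simp [hV0, hTw]
    | succ j ih =>
      rw [hVsucc, ih, hTw, List.range_succ (n := j + 1), List.map_append, List.flatMap_append]
      simp
  intro j
  rw [hV, Reducts_flatMap hUB (by simpa using fun i _ => hinner i) (by rw [hprefix]; exact hsf _),
    ncard_Blocks (fun A hA => (hUB.reaches hA.1).1)]
  simp
end

section
/- Every square-free word of length 9 over the alphabet {a,b,c} contains, as a (contiguous) factor, the image under some permutation of the alphabet {a,b,c} of one of the five words X_1 = abcabac, X_2 = abcacba, X_3 = abcbabc, X_4 = abcbacab, X_5 = abcbacb. -/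
theorem SquareFree.tail {α : Type*} {a : α} {W : List α} (h : SquareFree (a :: W)) :
    SquareFree W :=
  fun X hX hW => h X hX (hW.trans (List.suffix_cons a W).isInfix)

/-- No square `X ++ X` with `X` nonempty is a prefix of `W`. -/
def NoSquarePrefix {α : Type*} [DecidableEq α] (W : List α) : Bool :=
  (List.range W.length).all fun k => !((W.take (k + 1) ++ W.take (k + 1)).isPrefixOf W)

theorem SquareFree.noSquarePrefix {α : Type*} [DecidableEq α] {W : List α}
    (h : SquareFree W) : NoSquarePrefix W = true := by
  simp only [NoSquarePrefix, List.all_eq_true, List.mem_range, Bool.not_eq_true',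
    Bool.eq_false_iff, ne_eq, List.isPrefixOf_iff_prefix]
  intro k hk hp
  refine h (W.take (k + 1)) (fun h0 => ?_) hp.isInfix
  have := congrArg List.length h0
  simp at this
  simp [this] at hk

/-- The square-free ternary words of a given length, built by adding letters on the left. -/
def squareFreeWords : ℕ → List (List (Fin 3))
  | 0 => [[]]
  | n + 1 => (squareFreeWords n).flatMap fun W =>
      ([0, 1, 2].map (· :: W)).filter NoSquarePrefix

theorem SquareFree.mem_squareFreeWords {W : List (Fin 3)} (h : SquareFree W) :
    W ∈ squareFreeWords W.length := by
  induction W with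
  | nil => simp [squareFreeWords]
  | cons a W ih =>
    simp only [List.length_cons, squareFreeWords, List.mem_flatMap, List.mem_filter, List.mem_map]
    exact ⟨W, ih h.tail, ⟨a, by fin_cases a <;> simp, rfl⟩, h.noSquarePrefix⟩

theorem exists_special_factor_of_mem_squareFreeWords :
    ∀ W ∈ squareFreeWords 9,
      ∃ X ∈ ([[0,1,2,0,1,0,2], [0,1,2,0,2,1,0], [0,1,2,1,0,1,2],
            [0,1,2,1,0,2,0,1], [0,1,2,1,0,2,1]] : List (List (Fin 3))),
        ∃ π : Equiv.Perm (Fin 3), X.map π <:+: W := by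
  decide +kernel

/-- Every square-free ternary word of length `9` contains, up to a permutation of the
alphabet, one of `abcabac`, `abcacba`, `abcbabc`, `abcbacab`, `abcbacb` as a factor
(letters of `Fin 3`: `a = 0`, `b = 1`, `c = 2`). -/
theorem length_nine_contains_special_factor (W : List (Fin 3))
    (hlen : W.length = 9) (hsf : SquareFree W) :
    ∃ (π : Equiv.Perm (Fin 3)) (X : List (Fin 3)),
      X ∈ ([[0,1,2,0,1,0,2], [0,1,2,0,2,1,0], [0,1,2,1,0,1,2],
            [0,1,2,1,0,2,0,1], [0,1,2,1,0,2,1]] : List (List (Fin 3))) ∧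
      X.map π <:+: W := by
  obtain ⟨X, hX, π, h⟩ :=
    exists_special_factor_of_mem_squareFreeWords W (hlen ▸ hsf.mem_squareFreeWords)
  exact ⟨π, X, hX, h⟩
end
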